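/- (Plus minus generalized Van Kampen–Flores theorem.) Let d ≥ 1 be an integer, let r ≥ 2 be a prime power, set N = (r−1)(d+2) and k = ⌈((r−1)/r)·d⌉. Let a : Δ_N → ℝ^d be an affine map, and let μ be a face of Δ_N of dimension at most r−2 (that is, card(vert(μ)) ≤ r−1) such that a(μ) ∩ a(μ') = ∅. Then there exist r pairwise disjoint nonempty faces σ_1,…,σ_r of Δ_N, each of dimension at most k (that is, card(vert(σ_j)) ≤ k+1 for every j), a point b ∈ ℝ^d, and real coefficients α_v for v ∈ vert(σ_1) ∪ … ∪ vert(σ_r), such that for every j ∈ {1,…,r}: b = Σ_{v ∈ vert(σ_j)} α_v a(v) and Σ_{v ∈ vert(σ_j)} α_v = 1, with α_v ≤ 0 for every v ∈ vert(μ) and α_v ≥ 0 for every v ∈ vert(μ'). -/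

import Mathlib

/-! ### Alternating chains -/

namespace AltChain

section Basic

variable {k E : Type*} [Field k]

/-- A function on lists of vertices is alternating if it changes sign under adjacent transpositions
and vanishes on lists with two equal adjacent entries. -/
def IsAlt (f : List E → k) : Prop :=
  ∀ l a b l', f (l ++ a :: b :: l') = -f (l ++ b :: a :: l') ∧ f (l ++ a :: a :: l') = 0

lemma IsAlt.cons {f : List E → k} (hf : IsAlt f) (e : E) : IsAlt fun l => f (e :: l) :=
  fun l a b l' => hf (e :: l) a b l'

lemma IsAlt.eq_zero_of_mem {f : List E → k} (hf : IsAlt f) (a : E) (l₁ l₂ : List E) :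
    f (a :: (l₁ ++ a :: l₂)) = 0 := by
  induction l₁ generalizing f with
  | nil => exact (hf [] a a l₂).2
  | cons b l ih =>
    have h1 := (hf [] a b (l ++ a :: l₂)).1
    have h2 := ih (hf.cons b)
    simp only [List.nil_append] at h1
    simp only [List.cons_append, h1, h2, neg_zero]

lemma IsAlt.nodup {f : List E → k} (hf : IsAlt f) {l : List E} (hl : f l ≠ 0) : l.Nodup := by
  induction l generalizing f with
  | nil => exact List.nodup_nil
  | cons a l ih =>
    refine List.nodup_cons.2 ⟨fun ha => ?_, ih (hf.cons a) hl⟩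
    obtain ⟨l₁, l₂, rfl⟩ := List.append_of_mem ha
    exact hl (hf.eq_zero_of_mem a l₁ l₂)

/-- The cone over a chain with a given apex. -/
def coneFun [DecidableEq E] (w : E) : List E → (List E → k) → k
  | [], _ => 0
  | e :: l, f => (if e = w then f l else 0) - coneFun w l fun l' => f (e :: l')

lemma coneFun_add [DecidableEq E] (w : E) (l : List E) (f g : List E → k) :
    coneFun w l (f + g) = coneFun w l f + coneFun w l g := by
  induction l generalizing f g with
  | nil => simp [coneFun]
  | cons e l ih =>
    have h : coneFun w l (fun l' => (f + g) (e :: l')) = _ :=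
      ih (fun l' => f (e :: l')) (fun l' => g (e :: l'))
    simp only [coneFun]
    rw [h, Pi.add_apply]
    split_ifs <;> ring

lemma coneFun_smul [DecidableEq E] (w : E) (l : List E) (c : k) (f : List E → k) :
    coneFun w l (c • f) = c * coneFun w l f := by
  induction l generalizing f with
  | nil => simp [coneFun]
  | cons e l ih =>
    have h : coneFun w l (fun l' => (c • f) (e :: l')) = _ := ih (fun l' => f (e :: l'))
    simp only [coneFun]
    rw [h, Pi.smul_apply, smul_eq_mul]
    split_ifs <;> ring

/-- The cone over a chain with a given apex, as a linear map. -/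
def cone [DecidableEq E] (w : E) : (List E → k) →ₗ[k] (List E → k) where
  toFun f l := coneFun w l f
  map_add' f g := funext fun l => coneFun_add w l f g
  map_smul' c f := funext fun l => coneFun_smul w l c f

/-- The boundary of a chain. -/
def bd [Fintype E] : (List E → k) →ₗ[k] (List E → k) where
  toFun f l := ∑ e, f (e :: l)
  map_add' f g := by funext l; simp [Finset.sum_add_distrib]
  map_smul' c f := by funext l; simp [Finset.mul_sum]

/-- Multiplication of a chain by a function of the underlying face. -/
def diag [DecidableEq E] (ψ : Finset E → k) : (List E → k) →ₗ[k] (List E → k) where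
  toFun f l := ψ l.toFinset * f l
  map_add' f g := by funext l; simp [mul_add]
  map_smul' c f := by funext l; simp [mul_left_comm]

lemma bd_apply [Fintype E] (f : List E → k) (l : List E) : bd f l = ∑ e, f (e :: l) := rfl

lemma diag_apply [DecidableEq E] (ψ : Finset E → k) (f : List E → k) (l : List E) :
    diag ψ f l = ψ l.toFinset * f l := rfl

lemma isAlt_bd [Fintype E] {f : List E → k} (hf : IsAlt f) : IsAlt (bd f) := by
  intro l a b l'
  simp only [bd_apply]
  constructor
  · rw [← Finset.sum_neg_distrib]
    exact Finset.sum_congr rfl fun e _ => (hf.cons e l a b l').1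
  · exact Finset.sum_eq_zero fun e _ => (hf.cons e l a b l').2

lemma bd_bd [Fintype E] {f : List E → k} (hf : IsAlt f) : bd (bd f) = 0 := by
  classical
  funext l
  simp only [bd_apply, Pi.zero_apply]
  rw [← Finset.sum_product']
  refine Finset.sum_involution (fun p _ => (p.2, p.1)) ?_ ?_ ?_ ?_
  · rintro ⟨a, b⟩ -
    have := (hf [] b a l).1
    simp only [List.nil_append] at this
    simp [this]
  · rintro ⟨a, b⟩ - h hab
    simp only [Prod.mk.injEq] at hab
    obtain ⟨rfl, -⟩ := hab
    exact h (hf [] b b l).2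
  · simp
  · simp

variable [DecidableEq E]

lemma cone_cons (w : E) (f : List E → k) (e : E) (l : List E) :
    cone w f (e :: l) = (if e = w then f l else 0) - cone w (fun l' => f (e :: l')) l := rfl

lemma bd_cone [Fintype E] (w : E) (f : List E → k) : bd (cone w f) = f - cone w (bd f) := by
  have h : bd f = ∑ e, fun l => f (e :: l) := by
    funext l
    simp [bd_apply]
  funext l
  rw [bd_apply, h, map_sum]
  simp [cone_cons, Finset.sum_sub_distrib]

lemma isAlt_cone (w : E) {f : List E → k} (hf : IsAlt f) : IsAlt (cone w f) := by
  intro l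
  induction l generalizing f with
  | nil =>
    intro a b l'
    have h1 : (fun l => f (a :: b :: l)) = -fun l => f (b :: a :: l) := by
      funext l
      exact (hf [] a b l).1
    have h2 : (fun l => f (a :: a :: l)) = 0 := by
      funext l
      exact (hf [] a a l).2
    constructor
    · simp only [List.nil_append, cone_cons, h1, map_neg, Pi.neg_apply]
      ring
    · simp only [List.nil_append, cone_cons, h2, map_zero, Pi.zero_apply]
      ring
  | cons e l ih =>
    intro a b l'
    have h1 := hf l a b l'
    have h2 := ih (hf.cons e) a b l'
    simp only [List.cons_append, cone_cons, h1.1, h1.2, h2.1, h2.2]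
    constructor
    · split_ifs <;> ring
    · split_ifs <;> ring

lemma cone_support (w : E) {f : List E → k} {l : List E} (h : cone w f l ≠ 0) :
    ∃ l', f l' ≠ 0 ∧ l.Perm (w :: l') := by
  induction l generalizing f with
  | nil => exact absurd rfl h
  | cons e l ih =>
    rw [cone_cons] at h
    by_cases h1 : cone w (fun l' => f (e :: l')) l = 0
    · by_cases he : e = w
      · subst he
        simp only [if_true, h1, sub_zero] at h
        exact ⟨l, h, List.Perm.refl _⟩
      · simp [he, h1] at h
    · obtain ⟨l', h2, h3⟩ := ih h1
      exact ⟨e :: l', h2, (h3.cons e).trans (List.Perm.swap _ _ _)⟩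

lemma isAlt_diag (ψ : Finset E → k) {f : List E → k} (hf : IsAlt f) : IsAlt (diag ψ f) := by
  intro l a b l'
  have h : (l ++ a :: b :: l').toFinset = (l ++ b :: a :: l').toFinset := by
    ext x
    simp only [List.mem_toFinset, List.mem_append, List.mem_cons]
    tauto
  simp only [diag_apply, h, (hf l a b l').1, (hf l a b l').2]
  constructor <;> ring

/-- Alternating chains of degree `n` (on `n` vertices) supported on a family of faces. -/
def Chain (k : Type*) [Field k] (𝓕 : Set (Finset E)) (n : ℕ) : Submodule k (List E → k) where
  carrier := {f | IsAlt f ∧ ∀ l, f l ≠ 0 → l.length = n ∧ l.toFinset ∈ 𝓕}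
  add_mem' := by
    rintro f g ⟨hf, hf'⟩ ⟨hg, hg'⟩
    refine ⟨fun l a b l' => ?_, fun l hl => ?_⟩
    · simp only [Pi.add_apply, (hf l a b l').1, (hf l a b l').2, (hg l a b l').1, (hg l a b l').2]
      constructor <;> ring
    · by_cases h : f l = 0
      · exact hg' l (by simpa [h] using hl)
      · exact hf' l h
  zero_mem' := ⟨fun l a b l' => by simp, fun l hl => absurd rfl hl⟩
  smul_mem' := by
    rintro c f ⟨hf, hf'⟩
    refine ⟨fun l a b l' => ?_, fun l hl => hf' l fun h => hl (by simp [h])⟩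
    simp only [Pi.smul_apply, smul_eq_mul, (hf l a b l').1, (hf l a b l').2]
    constructor <;> ring

lemma chain_mono {𝓕 𝓖 : Set (Finset E)} (h : 𝓕 ⊆ 𝓖) {n : ℕ} {f : List E → k}
    (hf : f ∈ Chain k 𝓕 n) : f ∈ Chain k 𝓖 n :=
  ⟨hf.1, fun l hl => ⟨(hf.2 l hl).1, h (hf.2 l hl).2⟩⟩

lemma card_of_ne_zero {𝓕 : Set (Finset E)} {n : ℕ} {f : List E → k} (hf : f ∈ Chain k 𝓕 n)
    {l : List E} (hl : f l ≠ 0) : l.toFinset.card = n := by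
  rw [List.toFinset_card_of_nodup (hf.1.nodup hl), (hf.2 l hl).1]

lemma chain_eq_zero_of_card_lt [Fintype E] {𝓕 : Set (Finset E)} {n : ℕ}
    (hn : Fintype.card E < n) {f : List E → k} (hf : f ∈ Chain k 𝓕 n) : f = 0 := by
  funext l
  by_contra hl
  have h1 := card_of_ne_zero hf hl
  have h2 := Finset.card_le_univ l.toFinset
  omega

lemma diag_mem {𝓕 𝓖 : Set (Finset E)} {n : ℕ} (ψ : Finset E → k) {f : List E → k}
    (hf : f ∈ Chain k 𝓕 n) (h : ∀ A ∈ 𝓕, ψ A ≠ 0 → A ∈ 𝓖) : diag ψ f ∈ Chain k 𝓖 n := by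
  refine ⟨isAlt_diag ψ hf.1, fun l hl => ?_⟩
  rw [diag_apply] at hl
  have h1 := hf.2 l (right_ne_zero_of_mul hl)
  exact ⟨h1.1, h _ h1.2 (left_ne_zero_of_mul hl)⟩

lemma cone_mem {𝓕 𝓖 : Set (Finset E)} {n : ℕ} (w : E) {f : List E → k}
    (hf : f ∈ Chain k 𝓕 n) (h : ∀ A ∈ 𝓕, insert w A ∈ 𝓖) : cone w f ∈ Chain k 𝓖 (n + 1) := by
  refine ⟨isAlt_cone w hf.1, fun l hl => ?_⟩
  obtain ⟨l', h1, h2⟩ := cone_support w hl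
  obtain ⟨h3, h4⟩ := hf.2 l' h1
  refine ⟨by rw [h2.length_eq, List.length_cons, h3], ?_⟩
  rw [List.toFinset_eq_of_perm _ _ h2, List.toFinset_cons]
  exact h _ h4

lemma bd_mem [Fintype E] {𝓕 𝓖 : Set (Finset E)} {n : ℕ} {f : List E → k}
    (hf : f ∈ Chain k 𝓕 (n + 1)) (h : ∀ e A, insert e A ∈ 𝓕 → A ∈ 𝓖) :
    bd f ∈ Chain k 𝓖 n := by
  refine ⟨isAlt_bd hf.1, fun l hl => ?_⟩
  rw [bd_apply] at hl
  obtain ⟨e, -, he⟩ := Finset.exists_ne_zero_of_sum_ne_zero hl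
  obtain ⟨h1, h2⟩ := hf.2 _ he
  rw [List.toFinset_cons] at h2
  exact ⟨by simpa using h1, h e _ h2⟩

/-- A family of faces is acyclic above `q` if all cycles on more than `q` vertices are
boundaries. -/
def AcyclicAbove [Fintype E] (k : Type*) [Field k] (𝓕 : Set (Finset E)) (q : ℕ) : Prop :=
  ∀ n, q < n → ∀ f ∈ Chain k 𝓕 n, bd f = 0 → ∃ h ∈ Chain k 𝓕 (n + 1), bd h = f

lemma acyclicAbove_of_cone [Fintype E] {𝓕 : Set (Finset E)} (w : E)
    (h : ∀ A ∈ 𝓕, insert w A ∈ 𝓕) (q : ℕ) : AcyclicAbove k 𝓕 q := by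
  intro n _ f hf hf0
  refine ⟨cone w f, cone_mem w hf h, ?_⟩
  rw [bd_cone, hf0, map_zero, sub_zero]

/-- Removing from a complex all faces in an upper set `𝓤` of faces of the simplex `T` changes the
homology only in the degrees where the faces of `T` not in `𝓤` have homology. -/
lemma acyclicAbove_of_removal [Fintype E] {𝓕 𝓤 : Set (Finset E)} {T : Finset E} {q q' : ℕ}
    (hT : T.Nonempty) (hq : q' < q) (hsub : ∀ A ∈ 𝓤, A ⊆ T) (hTF : ∀ A, A ⊆ T → A ∈ 𝓕)
    (hup : ∀ A ∈ 𝓤, ∀ B ∈ 𝓕, A ⊆ B → B ∈ 𝓤)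
    (hΓ : AcyclicAbove k {A | A ⊆ T ∧ A ∉ 𝓤} q') (hF : AcyclicAbove k (𝓕 \ 𝓤) q) :
    AcyclicAbove k 𝓕 q := by
  classical
  intro n hn f hf hf0
  obtain ⟨m, rfl⟩ : ∃ m, n = m + 1 := ⟨n - 1, by omega⟩
  obtain ⟨w, hw⟩ := hT
  set fr := diag (fun A => if A ∈ 𝓤 then (1 : k) else 0) f with hfr
  have hfr_apply : ∀ l, fr l = if l.toFinset ∈ 𝓤 then f l else 0 := by
    intro l
    simp [hfr, diag_apply]
  have hfrT : fr ∈ Chain k {A | A ⊆ T} (m + 1) :=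
    diag_mem _ hf fun A _ hA => hsub A (by by_contra h; simp [h] at hA)
  have hbd : bd fr ∈ Chain k {A | A ⊆ T ∧ A ∉ 𝓤} m := by
    have h1 : bd fr ∈ Chain k {A | A ⊆ T} m :=
      bd_mem hfrT fun e A h => (Finset.subset_insert e A).trans h
    refine ⟨h1.1, fun l hl => ⟨(h1.2 l hl).1, (h1.2 l hl).2, fun hlU => hl ?_⟩⟩
    have h2 : bd fr l = bd f l := by
      simp only [bd_apply]
      refine Finset.sum_congr rfl fun e _ => ?_
      rw [hfr_apply]
      split_ifs with h3
      · rfl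
      · by_contra h4
        refine h3 (hup _ hlU _ (hf.2 _ (Ne.symm h4)).2 ?_)
        rw [List.toFinset_cons]
        exact Finset.subset_insert _ _
    rw [h2, hf0]
    rfl
  obtain ⟨h', hh', hbh'⟩ := hΓ m (by omega) _ hbd (bd_bd hfrT.1)
  have hh'T : h' ∈ Chain k {A | A ⊆ T} (m + 1) := chain_mono (fun A hA => hA.1) hh'
  obtain ⟨h'', hh'', hbh''⟩ :=
    acyclicAbove_of_cone (k := k) (𝓕 := {A | A ⊆ T}) w
      (fun A hA => Finset.insert_subset hw hA) 0 (m + 1) (by omega) (fr - h')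
      (Submodule.sub_mem _ hfrT hh'T) (by rw [map_sub, hbh', sub_self])
  have h1 : f - fr ∈ Chain k (𝓕 \ 𝓤) (m + 1) := by
    have h2 : f - fr = diag (fun A => if A ∈ 𝓤 then (0 : k) else 1) f := by
      funext l
      simp only [Pi.sub_apply, hfr_apply, diag_apply]
      split_ifs <;> simp
    rw [h2]
    exact diag_mem _ hf fun A hA h => ⟨hA, by by_contra h3; simp [h3] at h⟩
  have h2 : h' ∈ Chain k (𝓕 \ 𝓤) (m + 1) := 
    chain_mono (𝓖 := 𝓕 \ 𝓤) (fun A hA => ⟨hTF A hA.1, hA.2⟩) hh'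
  obtain ⟨g, hg, hbg⟩ := hF (m + 1) hn (f - fr + h') (Submodule.add_mem _ h1 h2) (by
    rw [map_add, map_sub, hf0, hbh']; abel)
  refine ⟨g + h'', Submodule.add_mem _ (chain_mono (fun A hA => hA.1) hg)
    (chain_mono hTF hh''), ?_⟩
  rw [map_add, hbg, hbh'']
  abel

end Basic

/-! ### Families of vectors lying in an open half space are acyclic in high degrees -/

section Leray

open scoped RealInnerProductSpace

variable {E V : Type*} [NormedAddCommGroup V] [InnerProductSpace ℝ V]

/-- The sets of indices whose vectors lie in an open half space with normal vector in `S`. -/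
def posFamily (a : E → V) (S : Submodule ℝ V) (T : Finset E) : Set (Finset E) :=
  {B | B ⊆ T ∧ ∃ y ∈ S, ∀ e ∈ B, 0 < ⟪a e, y⟫}

/-- The point `x` is the point of least norm of the polyhedron in `S` determined by `B`. -/
def IsMinPoint (a : E → V) (S : Submodule ℝ V) (B : Finset E) (x : V) : Prop :=
  (x ∈ S ∧ ∀ e ∈ B, 1 ≤ ⟪a e, x⟫) ∧
    ∀ y ∈ S, (∀ e ∈ B, 1 ≤ ⟪a e, y⟫) → ⟪x, x⟫ ≤ ⟪x, y⟫

variable {a : E → V} {S : Submodule ℝ V} {T : Finset E}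

lemma exists_scale (A : Finset E) (f : E → ℝ) (hf : ∀ e ∈ A, 0 < f e) :
    ∃ c : ℝ, 0 < c ∧ ∀ e ∈ A, 1 ≤ c * f e := by
  refine ⟨1 + ∑ e ∈ A, 1 / f e, ?_, fun e he => ?_⟩
  · have : 0 ≤ ∑ e ∈ A, 1 / f e := Finset.sum_nonneg fun e he => (one_div_pos.2 (hf e he)).le
    linarith
  · have h1 : 1 / f e ≤ ∑ e ∈ A, 1 / f e :=
      Finset.single_le_sum (f := fun e => 1 / f e)
        (fun e he => (one_div_pos.2 (hf e he)).le) he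
    have h2 : 1 / f e ≤ 1 + ∑ e ∈ A, 1 / f e := by linarith
    exact (div_le_iff₀ (hf e he)).1 h2

lemma exists_isMinPoint [FiniteDimensional ℝ V] {B : Finset E} (hB : B ∈ posFamily a S T) :
    ∃ x, IsMinPoint a S B x := by
  obtain ⟨-, y, hyS, hy⟩ := hB
  obtain ⟨c, -, hc⟩ := exists_scale B _ hy
  set K : Set V := {x | x ∈ S ∧ ∀ e ∈ B, 1 ≤ ⟪a e, x⟫} with hK
  have hne : K.Nonempty := ⟨c • y, S.smul_mem c hyS, fun e he => by
    rw [real_inner_smul_right]; exact hc e he⟩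
  have hKe : K = (S : Set V) ∩ ⋂ e ∈ B, {x | 1 ≤ ⟪a e, x⟫} := by
    ext x; simp [hK]
  have hclosed : IsClosed K := by
    rw [hKe]
    refine (Submodule.closed_of_finiteDimensional S).inter ?_
    refine isClosed_biInter fun e _ => isClosed_le continuous_const ?_
    fun_prop
  have hconv : Convex ℝ K := by
    rw [hKe]
    refine (Submodule.convex S).inter (convex_iInter₂ fun e _ => ?_)
    exact convex_halfSpace_ge (innerₛₗ ℝ (a e)).isLinear 1
  obtain ⟨x, hx, hmin⟩ := exists_norm_eq_iInf_of_complete_convex hne hclosed.isComplete hconv 0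
  rw [norm_eq_iInf_iff_real_inner_le_zero hconv hx] at hmin
  refine ⟨x, hx, fun y hyS hy => ?_⟩
  have := hmin y ⟨hyS, hy⟩
  rw [zero_sub, inner_neg_left, inner_sub_right] at this
  linarith

lemma eq_of_inner_le {x y : V} (h1 : ⟪x, x⟫ ≤ ⟪x, y⟫) (h2 : ⟪y, y⟫ ≤ ⟪x, x⟫) : y = x := by
  have h : ⟪y - x, y - x⟫ ≤ 0 := by
    rw [inner_sub_left, inner_sub_right, inner_sub_right, real_inner_comm x y]
    linarith
  exact sub_eq_zero.1 (inner_self_eq_zero.1 (h.antisymm real_inner_self_nonneg))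

lemma IsMinPoint.unique {B : Finset E} {x y : V} (hx : IsMinPoint a S B x)
    (hy : IsMinPoint a S B y) : x = y := by
  have h1 := hx.2 y hy.1.1 hy.1.2
  have h2 := hy.2 x hx.1.1 hx.1.2
  have h : ⟪y - x, y - x⟫ ≤ 0 := by
    rw [inner_sub_left, inner_sub_right, inner_sub_right]
    linarith
  exact (sub_eq_zero.1 (inner_self_eq_zero.1 (h.antisymm real_inner_self_nonneg))).symm

lemma IsMinPoint.of_insert [DecidableEq E] {A : Finset E} {x : V} {e : E}
    (h : IsMinPoint a S (insert e A) x) (he : 1 < ⟪a e, x⟫) : IsMinPoint a S A x := by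
  refine ⟨⟨h.1.1, fun e' he' => h.1.2 e' (Finset.mem_insert_of_mem he')⟩, fun y hyS hy => ?_⟩
  set c := ⟪a e, x⟫
  set d := ⟪a e, y⟫ with hd
  have hpos : 0 < c - 1 + |d - c| := by
    have := abs_nonneg (d - c)
    linarith
  set t := (c - 1) / (c - 1 + |d - c|) with ht
  have ht0 : 0 < t := div_pos (by linarith) hpos
  have ht1 : t ≤ 1 := by
    rw [ht, div_le_one hpos]
    linarith [abs_nonneg (d - c)]
  have ht2 : t * |d - c| ≤ c - 1 := by
    rw [ht, div_mul_eq_mul_div, div_le_iff₀ hpos]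
    nlinarith [abs_nonneg (d - c)]
  have h3 := h.2 (x + t • (y - x)) (S.add_mem h.1.1 (S.smul_mem t (S.sub_mem hyS h.1.1))) ?_
  · rw [inner_add_right, real_inner_smul_right, inner_sub_right] at h3
    nlinarith
  · intro e' he'
    rw [inner_add_right, real_inner_smul_right, inner_sub_right]
    rcases Finset.mem_insert.1 he' with rfl | h4
    · nlinarith [neg_abs_le (d - c)]
    · have h5 := hy e' h4
      have h6 := h.1.2 e' he'
      nlinarith

lemma not_isMinPoint_iff {A : Finset E} {x : V} (hx : x ∈ S) (hx0 : x ≠ 0)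
    (hA : ∀ e ∈ A, ⟪a e, x⟫ = 1) :
    ¬IsMinPoint a S A x ↔ ∃ v ∈ S ⊓ (ℝ ∙ x)ᗮ, ∀ e ∈ A, 0 < ⟪a e, v⟫ := by
  have hxx : 0 < ⟪x, x⟫ := real_inner_self_pos.2 hx0
  constructor
  · intro h
    have h1 : ¬∀ y ∈ S, (∀ e ∈ A, 1 ≤ ⟪a e, y⟫) → ⟪x, x⟫ ≤ ⟪x, y⟫ :=
      fun h1 => h ⟨⟨hx, fun e he => (hA e he).ge⟩, h1⟩
    push Not at h1
    obtain ⟨y, hyS, hy, hxy⟩ := h1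
    refine ⟨y - (⟪x, y⟫ / ⟪x, x⟫) • x, ⟨S.sub_mem hyS (S.smul_mem _ hx), ?_⟩, fun e he => ?_⟩
    · rw [SetLike.mem_coe, Submodule.mem_orthogonal_singleton_iff_inner_right, inner_sub_right,
        real_inner_smul_right, div_mul_cancel₀ _ hxx.ne', sub_self]
    · rw [inner_sub_right, real_inner_smul_right, hA e he]
      have := hy e he
      have h2 := (div_lt_one hxx).2 hxy
      linarith
  · rintro ⟨v, ⟨hvS, hvx⟩, hv⟩ h
    obtain ⟨c, hc, hc'⟩ := exists_scale A _ hv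
    rw [SetLike.mem_coe, Submodule.mem_orthogonal_singleton_iff_inner_right] at hvx
    have := h.2 ((1 / 2 : ℝ) • x + c • v) (S.add_mem (S.smul_mem _ hx) (S.smul_mem _ hvS)) ?_
    · rw [inner_add_right, real_inner_smul_right, real_inner_smul_right, hvx] at this
      linarith
    · intro e he
      rw [inner_add_right, real_inner_smul_right, real_inner_smul_right, hA e he]
      have := hc' e he
      linarith

variable {k : Type*} [Field k] [Fintype E] [DecidableEq E] [FiniteDimensional ℝ V]

lemma acyclicAbove_of_subset_singleton {𝓕 : Set (Finset E)} (h : ∀ A ∈ 𝓕, A = ∅) (q : ℕ) :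
    AcyclicAbove k 𝓕 q := by
  intro n hn f hf _
  have : f = 0 := by
    funext l
    by_contra hl
    have h1 := card_of_ne_zero hf hl
    rw [h _ (hf.2 l hl).2, Finset.card_empty] at h1
    omega
  exact ⟨0, Submodule.zero_mem _, by rw [map_zero, this]⟩

lemma acyclicAbove_of_saturated {q : ℕ} (hS : Module.finrank ℝ S ≤ q)
    (ih : ∀ q' < q, ∀ (S' : Submodule ℝ V) (T' : Finset E), Module.finrank ℝ S' ≤ q' →
      AcyclicAbove k (posFamily a S' T') q') (n : ℕ) :
    ∀ 𝓕 : Set (Finset E), 𝓕.ncard = n → 𝓕 ⊆ posFamily a S T →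
      (∀ B ∈ 𝓕, ∀ A ⊆ B, A ∈ 𝓕) →
      (∀ B ∈ 𝓕, ∀ B' ∈ posFamily a S T, ∀ x, IsMinPoint a S B x → IsMinPoint a S B' x → B' ∈ 𝓕) →
      AcyclicAbove k 𝓕 q := by
  induction n using Nat.strong_induction_on with
  | _ n ihn =>
  intro 𝓕 hcard h𝓕 hdown hsat
  rcases 𝓕.eq_empty_or_nonempty with rfl | hne
  · exact acyclicAbove_of_subset_singleton (fun A hA => absurd hA (Set.notMem_empty A)) q
  have hm : ∀ B : Finset E, ∃ x, B ∈ 𝓕 → IsMinPoint a S B x := fun B => by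
    by_cases hB : B ∈ 𝓕
    · obtain ⟨x, hx⟩ := exists_isMinPoint (h𝓕 hB)
      exact ⟨x, fun _ => hx⟩
    · exact ⟨0, fun h => absurd h hB⟩
  choose m hm using hm
  obtain ⟨B0, hB0, hmax⟩ := Set.exists_max_image 𝓕 (fun B => ⟪m B, m B⟫) 𝓕.toFinite hne
  set x := m B0
  have hx := hm B0 hB0
  have hB0p := h𝓕 hB0
  set 𝓤 : Set (Finset E) := {B | B ∈ posFamily a S T ∧ IsMinPoint a S B x} with h𝓤
  set B1 : Finset E := T.filter fun e => 1 ≤ ⟪a e, x⟫ with hB1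
  have hB01 : B0 ⊆ B1 := fun e he => Finset.mem_filter.2 ⟨hB0p.1 he, hx.1.2 e he⟩
  have hsub : ∀ A ∈ 𝓤, A ⊆ B1 := fun A hA e he =>
    Finset.mem_filter.2 ⟨hA.1.1 he, hA.2.1.2 e he⟩
  have hB1p : B1 ∈ posFamily a S T := ⟨Finset.filter_subset _ _, x, hx.1.1, fun e he =>
    lt_of_lt_of_le one_pos (Finset.mem_filter.1 he).2⟩
  have hB1x : IsMinPoint a S B1 x := ⟨⟨hx.1.1, fun e he => (Finset.mem_filter.1 he).2⟩,
    fun y hyS hy => hx.2 y hyS fun e he => hy e (hB01 he)⟩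
  have hB1F : B1 ∈ 𝓕 := hsat B0 hB0 B1 hB1p x hx hB1x
  have hTF : ∀ A, A ⊆ B1 → A ∈ 𝓕 := hdown B1 hB1F
  have hup : ∀ A ∈ 𝓤, ∀ B ∈ 𝓕, A ⊆ B → B ∈ 𝓤 := by
    intro A hA B hB hAB
    have hmB := hm B hB
    have h1 : ⟪x, x⟫ ≤ ⟪x, m B⟫ := hA.2.2 _ hmB.1.1 fun e he => hmB.1.2 e (hAB he)
    have h2 : m B = x := eq_of_inner_le h1 (hmax B hB)
    exact ⟨h𝓕 hB, h2 ▸ hmB⟩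
  rcases B1.eq_empty_or_nonempty with hB1e | hB1ne
  · refine acyclicAbove_of_subset_singleton (fun A hA => ?_) q
    rw [hB1e] at hB1x
    have := hsub A (hup ∅ ⟨h𝓕 (hdown _ hB0 _ (Finset.empty_subset _)), hB1x⟩ A hA
      (Finset.empty_subset _))
    rwa [hB1e, Finset.subset_empty] at this
  have hx0 : x ≠ 0 := by
    obtain ⟨e, he⟩ := hB1ne
    intro h
    have := (Finset.mem_filter.1 he).2
    rw [h, inner_zero_right] at this
    linarith
  have hlt : Module.finrank ℝ ↥(S ⊓ (ℝ ∙ x)ᗮ) < q := by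
    refine lt_of_lt_of_le (Submodule.finrank_lt_finrank_of_lt (lt_of_le_of_ne inf_le_left ?_)) hS
    intro h
    have h1 : x ∈ S ⊓ (ℝ ∙ x)ᗮ := h.ge hx.1.1
    have h2 := Submodule.mem_orthogonal_singleton_iff_inner_right.1 h1.2
    exact hx0 (inner_self_eq_zero.1 h2)
  have hF : AcyclicAbove k (𝓕 \ 𝓤) q := by
    refine ihn _ ?_ (𝓕 \ 𝓤) rfl (fun A hA => h𝓕 hA.1) ?_ ?_
    · rw [← hcard]
      refine Set.ncard_lt_ncard ⟨Set.sdiff_subset, fun h => ?_⟩ 𝓕.toFinite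
      exact (h hB0).2 ⟨hB0p, hx⟩
    · rintro B ⟨hB, hBU⟩ A hAB
      exact ⟨hdown B hB A hAB, fun hAU => hBU (hup A hAU B hB hAB)⟩
    · rintro B ⟨hB, hBU⟩ B' hB' z hz hz'
      refine ⟨hsat B hB B' hB' z hz hz', fun hBU' => hBU ⟨h𝓕 hB, ?_⟩⟩
      rwa [hBU'.2.unique hz']
  refine acyclicAbove_of_removal (q' := q - 1) hB1ne (by omega) hsub hTF hup ?_ hF
  by_cases hnt : ∃ e ∈ B1, 1 < ⟪a e, x⟫
  · obtain ⟨e, he, he1⟩ := hnt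
    refine acyclicAbove_of_cone e ?_ _
    rintro A ⟨hA, hAU⟩
    exact ⟨Finset.insert_subset he hA, fun h => hAU ⟨h𝓕 (hTF A hA), h.2.of_insert he1⟩⟩
  · push Not at hnt
    have htight : ∀ e ∈ B1, ⟪a e, x⟫ = 1 := fun e he =>
      le_antisymm (hnt e he) (Finset.mem_filter.1 he).2
    have hΓ : {A | A ⊆ B1 ∧ A ∉ 𝓤} = posFamily a (S ⊓ (ℝ ∙ x)ᗮ) B1 := by
      ext A
      refine and_congr_right fun hA => ?_
      rw [← not_isMinPoint_iff hx.1.1 hx0 fun e he => htight e (hA he)]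
      exact not_congr ⟨fun h => h.2, fun h => ⟨h𝓕 (hTF A hA), h⟩⟩
    rw [hΓ]
    exact ih (q - 1) (by omega) _ _ (by omega)

/-- The complex of sets of vectors lying in an open half space with normal vector in `S` has no
homology above the dimension of `S`. -/
theorem acyclicAbove_posFamily (q : ℕ) : ∀ (S : Submodule ℝ V) (T : Finset E),
    Module.finrank ℝ S ≤ q → AcyclicAbove k (posFamily a S T) q := by
  induction q using Nat.strong_induction_on with
  | _ q ih =>
  intro S T hS
  refine acyclicAbove_of_saturated (a := a) (S := S) (T := T) hS ih _ _ rfl subset_rfl ?_ ?_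
  · rintro B ⟨hB, y, hyS, hy⟩ A hAB
    exact ⟨hAB.trans hB, y, hyS, fun e he => hy e (hAB he)⟩
  · exact fun B _ B' hB' x _ _ => hB'

end Leray

/-! ### Exactness of powers of an elementary nilpotent operator -/

section Commutator

variable {R : Type*} [Ring R] (u s : R)

lemma iterate_commutator_mul (h : Commute u (u * s - s * u)) (m : ℕ) (t : R) :
    (fun x => u * x - x * u)^[m + 1] (s * t) = s * (fun x => u * x - x * u)^[m + 1] t +
      (m + 1 : ℕ) * ((u * s - s * u) * (fun x => u * x - x * u)^[m] t) := by
  induction m with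
  | zero =>
    simp only [zero_add, Function.iterate_one, Function.iterate_zero, id_eq, Nat.cast_one, one_mul]
    noncomm_ring
  | succ m ih =>
    rw [Function.iterate_succ_apply', ih]
    set y := (fun x => u * x - x * u)^[m] t with hy
    have h1 : (fun x => u * x - x * u)^[m + 1] t = u * y - y * u := by
      rw [Function.iterate_succ_apply']
    have h2 : (fun x => u * x - x * u)^[m + 1 + 1] t =
        u * (u * y - y * u) - (u * y - y * u) * u := by
      rw [Function.iterate_succ_apply', h1]
    rw [h1, h2]
    set w := u * s - s * u with hw
    set z := u * y - y * u with hz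
    have e1 : u * (s * z) - s * z * u = s * (u * z - z * u) + w * z := by
      rw [hw]; noncomm_ring
    have e2 : u * (w * y) - w * y * u = w * z := by
      rw [← mul_assoc, h.eq, hz]; noncomm_ring
    have e3 : u * (((m + 1 : ℕ) : R) * (w * y)) - ((m + 1 : ℕ) : R) * (w * y) * u =
        ((m + 1 : ℕ) : R) * (w * z) := by
      rw [← e2, ← mul_assoc, ((Nat.cast_commute (m + 1) u).symm).eq, mul_sub]
      simp only [mul_assoc]
    simp only [mul_add, add_mul]
    have e4 : u * (s * z) + u * (((m + 1 : ℕ) : R) * (w * y)) -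
        (s * z * u + ((m + 1 : ℕ) : R) * (w * y) * u) =
        (u * (s * z) - s * z * u) +
          (u * (((m + 1 : ℕ) : R) * (w * y)) - ((m + 1 : ℕ) : R) * (w * y) * u) := by
      abel
    rw [e4, e1, e3, Nat.cast_succ (m + 1), add_mul _ (1 : R), one_mul]
    abel

lemma iterate_commutator_pow (h : Commute u (u * s - s * u)) (n : ℕ) :
    (fun x => u * x - x * u)^[n + 1] (s ^ n) = 0 ∧
      (fun x => u * x - x * u)^[n] (s ^ n) = (n.factorial : R) * (u * s - s * u) ^ n := by
  induction n with
  | zero => simp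
  | succ n ih =>
    have e : (fun x => u * x - x * u) ((n.factorial : R) * (u * s - s * u) ^ n) = 0 := by
      have h1 : Commute u ((n.factorial : R) * (u * s - s * u) ^ n) :=
        ((Nat.cast_commute _ u).symm).mul_right (h.pow_right n)
      exact sub_eq_zero.2 h1.eq
    constructor
    · rw [pow_succ', iterate_commutator_mul u s h, ih.1, mul_zero, mul_zero,
        add_zero, Function.iterate_succ_apply', ih.1]
      simp
    · rw [pow_succ', iterate_commutator_mul u s h, ih.1, ih.2, mul_zero, zero_add,
        Nat.factorial_succ, Nat.cast_mul, mul_assoc, pow_succ' (u * s - s * u) n,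
        ← mul_assoc (u * s - s * u), ← (Nat.cast_commute n.factorial (u * s - s * u)).eq]
      simp only [mul_assoc]

end Commutator

section Exactness

variable {k M : Type*} [Field k] [AddCommGroup M] [Module k M]

lemma iterate_commutator_apply (u : Module.End k M) (P : Submodule k M)
    (hu : ∀ x ∈ P, u x ∈ P) (t : Module.End k M) (ht : ∀ x ∈ P, t x ∈ P) (m a : ℕ) (x : M)
    (hx : x ∈ P) (hax : (u ^ a) x = 0) :
    ∃ h ∈ P, (fun t => u * t - t * u)^[m] t x = (u ^ (m + 1 - a)) h := by
  induction m generalizing a x with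
  | zero =>
    rcases a with - | a
    · exact ⟨0, P.zero_mem, by simp only [pow_zero, Module.End.one_apply] at hax; simp [hax]⟩
    · exact ⟨t x, ht x hx, by simp⟩
  | succ m ih =>
    rcases a with - | a
    · exact ⟨0, P.zero_mem, by simp only [pow_zero, Module.End.one_apply] at hax; simp [hax]⟩
    obtain ⟨h1, hh1, e1⟩ := ih (a + 1) x hx hax
    obtain ⟨h2, hh2, e2⟩ := ih a (u x) (hu x hx) (by rwa [pow_succ] at hax)
    rw [Function.iterate_succ_apply', LinearMap.sub_apply, Module.End.mul_apply,
      Module.End.mul_apply, e1, e2]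
    rcases le_or_gt (m + 1) a with h | h
    · refine ⟨u h1 - h2, P.sub_mem (hu _ hh1) hh2, ?_⟩
      rw [show m + 1 - (a + 1) = 0 by omega, show m + 1 - a = 0 by omega,
        show m + 1 + 1 - (a + 1) = 0 by omega]
      simp
    · refine ⟨h1 - h2, P.sub_mem hh1 hh2, ?_⟩
      rw [show m + 1 + 1 - (a + 1) = m + 1 - a by omega, map_sub,
        show m + 1 - a = (m + 1 - (a + 1)) + 1 by omega, pow_succ']
      rfl

/-- If the commutator of `u` with some operator is invertible and commutes with `u` then the kernel
of `u ^ a` is contained in the image of `u ^ (p - a)`. -/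
lemma exists_pow_apply_eq (p : ℕ) [Fact p.Prime] [CharP k p] (u s : Module.End k M)
    (P : Submodule k M) (hu : ∀ x ∈ P, u x ∈ P) (hs : ∀ x ∈ P, s x ∈ P)
    (hcomm : Commute u (u * s - s * u))
    (hsurj : ∀ x ∈ P, ∃ y ∈ P, (u * s - s * u) y = x)
    (hinj : ∀ x ∈ P, (u * s - s * u) x = 0 → x = 0)
    (a : ℕ) (x : M) (hx : x ∈ P) (hax : (u ^ a) x = 0) :
    ∃ h ∈ P, (u ^ (p - a)) h = x := by
  have hp : p.Prime := Fact.out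
  set w := u * s - s * u with hw
  have hwP : ∀ x ∈ P, w x ∈ P := fun x hx =>
    P.sub_mem (hu _ (hs _ hx)) (hs _ (hu _ hx))
  have hsurj' : ∀ n, ∀ x ∈ P, ∃ y ∈ P, (w ^ n) y = x := by
    intro n
    induction n with
    | zero => exact fun x hx => ⟨x, hx, rfl⟩
    | succ n ih =>
      intro x hx
      obtain ⟨y, hy, rfl⟩ := hsurj x hx
      obtain ⟨z, hz, rfl⟩ := ih y hy
      exact ⟨z, hz, by rw [pow_succ']; rfl⟩
  have hinj' : ∀ n, ∀ x ∈ P, (w ^ n) x = 0 → x = 0 := by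
    intro n
    induction n with
    | zero => exact fun x _ h => h
    | succ n ih =>
      intro x hx h
      rw [pow_succ] at h
      exact hinj x hx (ih _ (hwP x hx) h)
  obtain ⟨y, hy, hyx⟩ := hsurj' (p - 1) x hx
  have hpow : ∀ n, ∀ x ∈ P, (u ^ n) x ∈ P := by
    intro n
    induction n with
    | zero => exact fun x hx => hx
    | succ n ih =>
      intro x hx
      rw [pow_succ]
      exact ih _ (hu x hx)
  have hay : (u ^ a) y = 0 := by
    refine hinj' (p - 1) _ (hpow a y hy) ?_
    rw [← Module.End.mul_apply, ← (hcomm.pow_pow a (p - 1)).eq, Module.End.mul_apply, hyx, hax]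
  have hspow : ∀ x ∈ P, (s ^ (p - 1)) x ∈ P := by
    generalize p - 1 = n
    induction n with
    | zero => exact fun x hx => hx
    | succ n ih =>
      intro x hx
      rw [pow_succ]
      exact ih _ (hs x hx)
  obtain ⟨h, hh, e⟩ := iterate_commutator_apply u P hu (s ^ (p - 1)) hspow (p - 1) a y hy hay
  rw [(iterate_commutator_pow u s hcomm (p - 1)).2, Module.End.mul_apply, ← hw, hyx,
    show p - 1 + 1 - a = p - a by have := hp.one_lt; omega] at e
  have hne : ((p - 1).factorial : k) ≠ 0 := by
    rw [Ne, CharP.cast_eq_zero_iff k p, hp.dvd_factorial]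
    have := hp.one_lt
    omega
  refine ⟨((p - 1).factorial : k)⁻¹ • h, P.smul_mem _ hh, ?_⟩
  rw [map_smul, ← e, Module.End.natCast_apply, ← Nat.cast_smul_eq_nsmul k, smul_smul,
    inv_mul_cancel₀ hne, one_smul]

end Exactness

/-- An action of an elementary abelian group admits a function that is additive on orbits, with
nonzero slope on every nontrivial orbit. -/
lemma exists_orbit_cocycle (p : ℕ) [Fact p.Prime] {F : Type*} [AddCommGroup F]
    [Module (ZMod p) F] (X : Type*) [AddAction F X] :
    ∃ (ψ : X → ZMod p) (χ : X → F →ₗ[ZMod p] ZMod p), (∀ g x, ψ (g +ᵥ x) = ψ x + χ x g) ∧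
      (∀ (g : F) x, χ (g +ᵥ x) = χ x) ∧ ∀ x, (∃ g : F, g +ᵥ x ≠ x) → χ x ≠ 0 := by
  have hχ : ∀ H : Submodule (ZMod p) F, ∃ f : F →ₗ[ZMod p] ZMod p,
      H ≤ LinearMap.ker f ∧ (H ≠ ⊤ → f ≠ 0) := by
    intro H
    by_cases hH : H = ⊤
    · exact ⟨0, by simp, fun h => absurd hH h⟩
    · obtain ⟨f, hf, hHf⟩ := Submodule.exists_le_ker_of_lt_top H (lt_top_iff_ne_top.2 hH)
      exact ⟨f, hHf, fun _ => hf⟩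
  choose f hf hf0 using hχ
  let stab : X → Submodule (ZMod p) F := fun x =>
    AddSubgroup.toZModSubmodule p (AddAction.stabilizer F x)
  have hmem : ∀ x g, g ∈ stab x ↔ g +ᵥ x = x := fun x g => Iff.rfl
  have hstab : ∀ (g : F) x, stab (g +ᵥ x) = stab x := by
    intro g x
    ext h
    rw [hmem, hmem, vadd_vadd, add_comm, ← vadd_vadd]
    exact (AddAction.injective g).eq_iff
  let rep : X → X := fun x => (Quotient.mk (AddAction.orbitRel F X) x).out
  have hrep : ∀ x, ∃ g : F, g +ᵥ rep x = x := by
    intro x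
    have h1 : AddAction.orbitRel F X (rep x) x := Quotient.mk_out (s := AddAction.orbitRel F X) x
    have h2 := AddAction.orbitRel_apply.1 ((AddAction.orbitRel F X).symm h1)
    exact h2
  have hrep' : ∀ (g : F) x, rep (g +ᵥ x) = rep x := by
    intro g x
    have : Quotient.mk (AddAction.orbitRel F X) (g +ᵥ x) = Quotient.mk (AddAction.orbitRel F X) x :=
      Quotient.sound (s := AddAction.orbitRel F X) (AddAction.orbitRel_apply.2 ⟨g, rfl⟩)
    exact congrArg Quotient.out this
  choose c hc using hrep
  refine ⟨fun x => f (stab x) (c x), fun x => f (stab x), fun g x => ?_, fun g x => ?_,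
    fun x ⟨g, hg⟩ => hf0 _ fun h => hg ?_⟩
  · simp only [hstab]
    have h1 : c (g +ᵥ x) - (c x + g) ∈ stab x := by
      have h2 : stab (rep x) = stab x := by
        conv_rhs => rw [← hc x]
        rw [hstab]
      rw [← h2, hmem, sub_eq_neg_add, ← vadd_vadd, ← hrep' g x, hc, neg_vadd_eq_iff, hrep',
        add_comm, ← vadd_vadd, hc]
    have h2 := hf _ h1
    rw [LinearMap.mem_ker, map_sub, sub_eq_zero, map_add] at h2
    exact h2
  · simp only [hstab]
  · rw [← hmem, h]
    exact Submodule.mem_top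


section Equivariant

open scoped Pointwise

lemma sum_pow_char_of_commute {R ι : Type*} [Ring R] (p : ℕ) [Fact p.Prime] [CharP R p]
    (s : Finset ι) (x : ι → R) (h : ∀ i j, Commute (x i) (x j)) :
    (∑ i ∈ s, x i) ^ p = ∑ i ∈ s, x i ^ p := by
  classical
  induction s using Finset.induction_on with
  | empty => simp [(Fact.out : p.Prime).ne_zero]
  | insert i s hi ih =>
    rw [Finset.sum_insert hi, Finset.sum_insert hi,
      add_pow_char_of_commute _ (Commute.sum_right _ _ _ fun j _ => h i j), ih]

section Diag

variable {F E : Type*} [Field F] [DecidableEq E]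

lemma diag_mul (ψ φ : Finset E → F) :
    (diag ψ * diag φ : Module.End F (List E → F)) = diag (ψ * φ) := by
  refine LinearMap.ext fun f => funext fun l => ?_
  rw [Module.End.mul_apply, diag_apply, diag_apply, diag_apply, Pi.mul_apply, mul_assoc]

lemma diag_one : (diag 1 : Module.End F (List E → F)) = 1 := by
  refine LinearMap.ext fun f => funext fun l => ?_
  rw [diag_apply, Pi.one_apply, one_mul, Module.End.one_apply]

lemma diag_pow (ψ : Finset E → F) (n : ℕ) :
    (diag ψ : Module.End F (List E → F)) ^ n = diag (ψ ^ n) := by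
  induction n with
  | zero => rw [pow_zero, pow_zero, diag_one]
  | succ n ih => rw [pow_succ, ih, diag_mul, pow_succ]

lemma diag_commute (ψ φ : Finset E → F) :
    Commute (diag ψ : Module.End F (List E → F)) (diag φ) := by
  rw [commute_iff_eq, diag_mul, diag_mul, mul_comm]

end Diag

variable {F E : Type*} [Field F] [AddAction F E]

/-- The action of a translation on chains. -/
def translate (g : F) : Module.End F (List E → F) where
  toFun f l := f (l.map (-g +ᵥ ·))
  map_add' _ _ := rfl
  map_smul' _ _ := rfl

lemma translate_apply (g : F) (f : List E → F) (l : List E) :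
    translate g f l = f (l.map (-g +ᵥ ·)) := rfl

lemma translate_add (g h : F) :
    (translate (g + h) : Module.End F (List E → F)) = translate g * translate h := by
  refine LinearMap.ext fun f => funext fun l => ?_
  rw [Module.End.mul_apply, translate_apply, translate_apply, translate_apply, List.map_map]
  congr 2
  funext e
  rw [Function.comp_apply, vadd_vadd, neg_add_rev]

lemma translate_zero : (translate 0 : Module.End F (List E → F)) = 1 := by
  refine LinearMap.ext fun f => funext fun l => ?_
  rw [translate_apply, Module.End.one_apply]
  congr 1
  simp

lemma translate_commute (g h : F) :
    Commute (translate g : Module.End F (List E → F)) (translate h) := by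
  rw [commute_iff_eq, ← translate_add, add_comm, translate_add]

lemma translate_pow (g : F) (n : ℕ) :
    (translate g : Module.End F (List E → F)) ^ n = translate (n • g) := by
  induction n with
  | zero => rw [pow_zero, zero_smul, translate_zero]
  | succ n ih => rw [pow_succ, ih, succ_nsmul, translate_add]

lemma translate_pow_char (p : ℕ) [CharP F p] (g : F) :
    (translate g : Module.End F (List E → F)) ^ p = 1 := by
  rw [translate_pow, nsmul_eq_mul, CharP.cast_eq_zero, zero_mul, translate_zero]

lemma bd_translate [Fintype E] (g : F) (f : List E → F) :
    bd (translate g f) = translate g (bd f) := by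
  funext l
  rw [translate_apply, bd_apply, bd_apply]
  exact Equiv.sum_comp (AddAction.toPerm (-g)) fun e => f (e :: l.map (-g +ᵥ ·))

lemma isAlt_translate (g : F) {f : List E → F} (hf : IsAlt f) : IsAlt (translate g f) := by
  intro l a b l'
  simp only [translate_apply, List.map_append, List.map_cons]
  exact hf _ _ _ _

instance charP_end (p : ℕ) [CharP F p] : CharP (Module.End F (List E → F)) p :=
  charP_of_injective_algebraMap (algebraMap F (Module.End F (List E → F))).injective p

section

variable [DecidableEq E]

lemma toFinset_map_vadd (g : F) (l : List E) : (l.map (g +ᵥ ·)).toFinset = g +ᵥ l.toFinset := by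
  ext x
  simp [Finset.mem_vadd_finset]

lemma translate_mem {𝓕 : Set (Finset E)} (h𝓕 : ∀ (g : F), ∀ A ∈ 𝓕, g +ᵥ A ∈ 𝓕) {n : ℕ} (g : F)
    {f : List E → F} (hf : f ∈ Chain F 𝓕 n) : translate g f ∈ Chain F 𝓕 n := by
  refine ⟨isAlt_translate g hf.1, fun l hl => ?_⟩
  obtain ⟨h1, h2⟩ := hf.2 _ hl
  rw [toFinset_map_vadd] at h2
  refine ⟨by simpa using h1, ?_⟩
  simpa using h𝓕 g _ h2

lemma translate_mul_diag (g : F) (ψ : Finset E → F) :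
    (translate g * diag ψ : Module.End F (List E → F)) =
      diag (fun A => ψ (-g +ᵥ A)) * translate g := by
  refine LinearMap.ext fun f => funext fun l => ?_
  rw [Module.End.mul_apply, Module.End.mul_apply, translate_apply, diag_apply, diag_apply,
    translate_apply, toFinset_map_vadd]

end

variable [Fintype F] (p : ℕ) [Fact p.Prime] [Algebra (ZMod p) F]

/-- A nilpotent element of the group algebra, acting on chains. -/
noncomputable def nilOp (F E : Type*) [Field F] [AddAction F E] [Fintype F] (p : ℕ)
    [Fact p.Prime] [Algebra (ZMod p) F] : Module.End F (List E → F) :=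
  ∑ i, Module.finBasis (ZMod p) F i • (translate (Module.finBasis (ZMod p) F i) - 1)

lemma nilOp_apply (f : List E → F) : nilOp F E p f =
    ∑ i, Module.finBasis (ZMod p) F i • (translate (Module.finBasis (ZMod p) F i) f - f) := by
  simp [nilOp, LinearMap.sum_apply]

lemma nilOp_pow_char [CharP F p] : nilOp F E p ^ p = 0 := by
  have h : ∀ g h : F, Commute (translate g - 1 : Module.End F (List E → F)) (translate h - 1) :=
    fun g h => ((translate_commute g h).sub_left (Commute.one_left _)).sub_right
      (Commute.one_right _)
  rw [nilOp, sum_pow_char_of_commute p _ _ fun i j => ((h _ _).smul_left _).smul_right _]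
  refine Finset.sum_eq_zero fun i _ => ?_
  rw [smul_pow, sub_pow_char_of_commute _ (Commute.one_right _), translate_pow_char, one_pow,
    sub_self, smul_zero]

lemma bd_nilOp [Fintype E] : Commute (bd : Module.End F (List E → F)) (nilOp F E p) := by
  refine Commute.sum_right _ _ _ fun i _ => (Commute.sub_right ?_ (Commute.one_right _)).smul_right _
  exact LinearMap.ext fun f => bd_translate _ f

lemma bd_nilOp_pow_apply [Fintype E] (a : ℕ) (f : List E → F) :
    bd ((nilOp F E p ^ a) f) = (nilOp F E p ^ a) (bd f) :=
  LinearMap.congr_fun ((bd_nilOp p).pow_right a).eq f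

variable [DecidableEq E]

lemma nilOp_pow_mem {𝓕 : Set (Finset E)} (h𝓕 : ∀ (g : F), ∀ A ∈ 𝓕, g +ᵥ A ∈ 𝓕) {n : ℕ}
    {f : List E → F} (hf : f ∈ Chain F 𝓕 n) (a : ℕ) : (nilOp F E p ^ a) f ∈ Chain F 𝓕 n := by
  induction a generalizing f with
  | zero => exact hf
  | succ a ih =>
    rw [pow_succ]
    refine ih ?_
    rw [nilOp_apply]
    exact Submodule.sum_mem _ fun i _ => Submodule.smul_mem _ _
      (Submodule.sub_mem _ (translate_mem h𝓕 _ hf) hf)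

lemma nilOp_eq_zero_of_degree_zero {𝓕 : Set (Finset E)} {f : List E → F}
    (hf : f ∈ Chain F 𝓕 0) : nilOp F E p f = 0 := by
  rw [nilOp_apply]
  refine Finset.sum_eq_zero fun i _ => ?_
  rw [smul_eq_zero, sub_eq_zero]
  right
  funext l
  rw [translate_apply]
  rcases l with - | ⟨e, l⟩
  · rfl
  · by_contra h
    have h1 : ∀ l : List E, l ≠ [] → f l = 0 := fun l hl => by
      by_contra h2
      exact hl (List.length_eq_zero_iff.1 (hf.2 l h2).1)
    exact h (by rw [h1 _ (by simp), h1 _ (by simp)])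

/-- Let `D` be an invariant family with no invariant members. Then chains on `D` killed by a
power of `nilOp` are images of the complementary power of `nilOp`. -/
lemma exists_nilOp_pow_eq [CharP F p] {D : Set (Finset E)} (hD : ∀ (g : F), ∀ A ∈ D, g +ᵥ A ∈ D)
    {n : ℕ} (hfix : ∀ A ∈ D, A.card = n → ∃ g : F, g +ᵥ A ≠ A) (a : ℕ) {x : List E → F}
    (hx : x ∈ Chain F D n) (hax : (nilOp F E p ^ a) x = 0) :
    ∃ h ∈ Chain F D n, (nilOp F E p ^ (p - a)) h = x := by
  obtain ⟨ψ, χ, hψ, hχ, hχ0⟩ := exists_orbit_cocycle p (F := F) (Finset E)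
  set b := Module.finBasis (ZMod p) F with hb
  let φ : ZMod p →+* F := algebraMap (ZMod p) F
  let s : Module.End F (List E → F) := diag fun A => φ (ψ A)
  let C : F → Module.End F (List E → F) := fun g => diag fun A => φ (χ A g)
  let y := fun i => b i • (C (b i) * translate (b i))
  have hC : ∀ g h, Commute (translate g) (C h) := fun g h => by
    rw [commute_iff_eq, translate_mul_diag]
    simp only [hχ]
    rfl
  have hts : ∀ g : F, translate g * s = s * translate g - C g * translate g := by
    intro g
    rw [translate_mul_diag, ← sub_mul]
    congr 1
    refine LinearMap.ext fun f => funext fun l => ?_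
    rw [LinearMap.sub_apply, Pi.sub_apply, diag_apply, diag_apply, diag_apply, hψ, map_neg,
      map_add, map_neg]
    ring
  have hw : nilOp F E p * s - s * nilOp F E p = -∑ i, y i := by
    rw [nilOp, Finset.sum_mul, Finset.mul_sum, ← Finset.sum_sub_distrib, ← Finset.sum_neg_distrib]
    refine Finset.sum_congr rfl fun i _ => ?_
    rw [smul_mul_assoc, mul_smul_comm]
    refine (smul_sub (b i) _ _).symm.trans (Eq.trans ?_ (smul_neg (b i) _))
    rw [sub_mul, hts, mul_sub, one_mul, mul_one]
    congr 1
    abel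
  have hCC : ∀ g h, Commute (C g) (C h) := fun g h => diag_commute _ _
  have hyy : ∀ i j, Commute (y i) (y j) := by
    intro i j
    refine Commute.smul_left (Commute.smul_right ?_ _) _
    exact ((hCC _ _).mul_right (hC _ _).symm).mul_left ((hC _ _).mul_right (translate_commute _ _))
  have hyp : (∑ i, y i) ^ p = diag fun A => (∑ i, b i * φ (χ A (b i))) ^ p := by
    rw [sum_pow_char_of_commute p _ _ hyy]
    refine LinearMap.ext fun f => funext fun l => ?_
    rw [LinearMap.sum_apply, Finset.sum_apply, diag_apply, sum_pow_char, Finset.sum_mul]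
    refine Finset.sum_congr rfl fun i _ => ?_
    rw [smul_pow, (hC _ _).symm.mul_pow, translate_pow_char, mul_one, diag_pow,
      LinearMap.smul_apply, Pi.smul_apply, diag_apply, smul_eq_mul, mul_pow, mul_assoc]
    rfl
  have hne : ∀ A ∈ D, A.card = n → (∑ i, b i * φ (χ A (b i))) ^ p ≠ 0 := by
    intro A hA hAn h
    refine hχ0 A (hfix A hA hAn) (b.ext fun i => ?_)
    have h1 : ∑ i, χ A (b i) • b i = 0 := by
      rw [← pow_eq_zero_iff (Fact.out : p.Prime).ne_zero, ← h]
      congr 1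
      refine Finset.sum_congr rfl fun i _ => ?_
      rw [Algebra.smul_def, mul_comm]
    exact Fintype.linearIndependent_iff.1 b.linearIndependent _ h1 i
  have hnilt : ∀ g, Commute (nilOp F E p) (translate g) := fun g =>
    Commute.sum_left _ _ _ fun i _ =>
      ((translate_commute _ _).sub_left (Commute.one_left _)).smul_left _
  have hnilC : ∀ g, Commute (nilOp F E p) (C g) := fun g =>
    Commute.sum_left _ _ _ fun i _ => ((hC _ _).sub_left (Commute.one_left _)).smul_left _
  have hu : ∀ x ∈ Chain F D n, nilOp F E p x ∈ Chain F D n := fun x hx => by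
    simpa using nilOp_pow_mem p hD hx 1
  have hs : ∀ x ∈ Chain F D n, s x ∈ Chain F D n := fun x hx => diag_mem _ hx fun A hA _ => hA
  have hyP : ∀ x ∈ Chain F D n, (∑ i, y i) x ∈ Chain F D n := by
    intro x hx
    have : (∑ i, y i) x = -((nilOp F E p * s - s * nilOp F E p) x) := by
      rw [hw, LinearMap.neg_apply, neg_neg]
    rw [this]
    exact Submodule.neg_mem _ (Submodule.sub_mem _ (hu _ (hs _ hx)) (hs _ (hu _ hx)))
  have hyPn : ∀ m, ∀ x ∈ Chain F D n, ((∑ i, y i) ^ m) x ∈ Chain F D n := by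
    intro m
    induction m with
    | zero => exact fun x hx => hx
    | succ m ih =>
      intro x hx
      rw [pow_succ]
      exact ih _ (hyP x hx)
  have hp : p - 1 + 1 = p := Nat.sub_add_cancel (Fact.out : p.Prime).one_le
  refine exists_pow_apply_eq p (nilOp F E p) s (Chain F D n) hu hs ?_ ?_ ?_ a x hx hax
  · rw [hw]
    refine Commute.neg_right (Commute.sum_right _ _ _ fun i _ => Commute.smul_right ?_ _)
    exact (hnilC _).mul_right (hnilt _)
  · intro z hz
    rw [hw]
    refine ⟨-(((∑ i, y i) ^ (p - 1)) (diag (fun A => ((∑ i, b i * φ (χ A (b i))) ^ p)⁻¹) z)),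
      Submodule.neg_mem _ (hyPn _ _ (diag_mem _ hz fun A hA _ => hA)), ?_⟩
    rw [LinearMap.neg_apply, map_neg, neg_neg, ← Module.End.mul_apply, ← pow_succ', hp, hyp]
    funext l
    rw [diag_apply, diag_apply]
    by_cases hl : z l = 0
    · rw [hl, mul_zero, mul_zero]
    · exact mul_inv_cancel_left₀ (hne _ (hz.2 l hl).2 (card_of_ne_zero hz hl)) _
  · intro z hz h
    rw [hw, LinearMap.neg_apply, neg_eq_zero] at h
    have h1 : ((∑ i, y i) ^ (p - 1 + 1)) z = 0 := by
      rw [pow_succ, Module.End.mul_apply, h, map_zero]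
    rw [hp, hyp] at h1
    funext l
    by_contra hl
    have h2 := congrFun h1 l
    rw [diag_apply] at h2
    exact mul_ne_zero (hne _ (hz.2 l hl).2 (card_of_ne_zero hz hl)) hl h2

end Equivariant

section Tower

open scoped Pointwise

variable {F E : Type*} [Field F] [AddAction F E] [Fintype F] [Fintype E] [DecidableEq E]
  (p : ℕ) [Fact p.Prime] [Algebra (ZMod p) F] [CharP F p]

/-- The chain of degree zero given by the empty face. -/
def emptyChain (F E : Type*) [Field F] (l : List E) : F := if l.isEmpty then 1 else 0

lemma exists_bd_add_nilOp_pow {D : Set (Finset E)} (hD : ∀ (g : F), ∀ A ∈ D, g +ᵥ A ∈ D)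
    (hdown : ∀ A ∈ D, ∀ B ⊆ A, B ∈ D) (hfix : ∀ A ∈ D, A.Nonempty → ∃ g : F, g +ᵥ A ≠ A) {N : ℕ} (hN : AcyclicAbove F D N)
    (j : ℕ) : ∀ i, Fintype.card E + 1 ≤ i + j → N < i → ∀ x ∈ Chain F D i, ∀ a, 0 < a → a < p →
      bd ((nilOp F E p ^ a) x) = 0 →
      ∃ h ∈ Chain F D (i + 1), ∃ h' ∈ Chain F D i, x = bd h + (nilOp F E p ^ (p - a)) h' := by
  induction j with
  | zero =>
    intro i hi _ x hx a _ _ _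
    have : x = 0 := chain_eq_zero_of_card_lt (by omega) hx
    exact ⟨0, Submodule.zero_mem _, 0, Submodule.zero_mem _, by simp [this]⟩
  | succ j ih =>
    intro i hi hNi x hx a ha0 hap hbx
    obtain ⟨y, hy, hbdy⟩ := hN i hNi _ (nilOp_pow_mem p hD hx a) hbx
    obtain ⟨z, hz, h', hh', e⟩ := ih (i + 1) (by omega) (by omega) y hy (p - a) (by omega)
      (by omega) (by
        rw [bd_nilOp_pow_apply, hbdy, ← Module.End.mul_apply, ← pow_add,
          Nat.sub_add_cancel hap.le, nilOp_pow_char, LinearMap.zero_apply])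
    rw [show p - (p - a) = a by omega] at e
    have hx' : x - bd h' ∈ Chain F D i :=
      Submodule.sub_mem _ hx (bd_mem hh' fun e A hA => hdown _ hA _ (Finset.subset_insert _ _))
    have hker : (nilOp F E p ^ a) (x - bd h') = 0 := by
      rw [map_sub, ← hbdy, e, map_add, bd_bd hz.1, zero_add, bd_nilOp_pow_apply, sub_self]
    obtain ⟨h'', hh'', e'⟩ := exists_nilOp_pow_eq p hD (fun A hA hAi => hfix A hA
      (Finset.card_pos.1 (by omega))) a hx' hker
    exact ⟨h', hh', h'', hh'', by rw [e']; abel⟩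

/-- An invariant complex without invariant faces whose homology vanishes above degree `N` carries no
tower of chains over the empty face up to degree `N + 1`. -/
theorem false_of_tower {D : Set (Finset E)} (hD : ∀ (g : F), ∀ A ∈ D, g +ᵥ A ∈ D)
    (hdown : ∀ A ∈ D, ∀ B ⊆ A, B ∈ D) (hfix : ∀ A ∈ D, A.Nonempty → ∃ g : F, g +ᵥ A ≠ A)
    {N : ℕ} (hN0 : 0 < N) (hN : AcyclicAbove F D N) (a : ℕ → ℕ) (ha0 : ∀ i, 0 < a i)
    (hap : ∀ i, a i + a (i + 1) = p) (d : ℕ → List E → F) (hd0 : d 0 = emptyChain F E)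
    (hd : ∀ i ≤ N + 1, d i ∈ Chain F D i) (hd1 : bd (d 1) = d 0)
    (hdbd : ∀ i, 0 < i → i ≤ N → bd (d (i + 1)) = (nilOp F E p ^ a i) (d i)) : False := by
  have key : ∀ m i, i + m = N + 1 → 0 < i → ∃ h ∈ Chain F D (i + 1), ∃ h' ∈ Chain F D i,
      d i = bd h + (nilOp F E p ^ (p - a i)) h' := by
    intro m
    induction m with
    | zero =>
      rintro i hi -
      obtain rfl : i = N + 1 := by omega
      have h1 := ha0 (N + 1 + 1)
      have h2 := hap (N + 1)
      refine exists_bd_add_nilOp_pow p hD hdown hfix hN (Fintype.card E) (N + 1)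
        (by omega) (by omega) _ (hd _ le_rfl) _ (ha0 _) (by omega) ?_
      rw [bd_nilOp_pow_apply, hdbd N hN0 le_rfl, ← Module.End.mul_apply, ← pow_add,
        add_comm, hap, nilOp_pow_char, LinearMap.zero_apply]
    | succ m ih =>
      intro i hi hi0
      obtain ⟨h, hh, h', hh', e⟩ := ih (i + 1) (by omega) (by omega)
      have h1 := hap i
      rw [show p - a (i + 1) = a i by omega] at e
      have hx' : d i - bd h' ∈ Chain F D i := Submodule.sub_mem _ (hd i (by omega))
        (bd_mem hh' fun e A hA => hdown _ hA _ (Finset.subset_insert _ _))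
      have hker : (nilOp F E p ^ a i) (d i - bd h') = 0 := by
        rw [map_sub, ← hdbd i hi0 (by omega), e, map_add, bd_bd hh.1, zero_add,
          bd_nilOp_pow_apply, sub_self]
      obtain ⟨h'', hh'', e'⟩ := exists_nilOp_pow_eq p hD (fun A hA hAi => hfix A hA
        (Finset.card_pos.1 (by omega))) (a i) hx' hker
      exact ⟨h', hh', h'', hh'', by rw [e']; abel⟩
  obtain ⟨h, hh, h', hh', e⟩ := key N 1 (by omega) one_pos
  have h0 : bd h' ∈ Chain F D 0 :=
    bd_mem hh' fun e A hA => hdown _ hA _ (Finset.subset_insert _ _)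
  have h1 : p - a 1 = a 2 - 1 + 1 := by
    have h2 := hap 1
    have h3 := ha0 2
    simp only [Nat.reduceAdd] at h2
    omega
  have h2 : emptyChain F E = 0 := by
    rw [← hd0, ← hd1, e, map_add, bd_bd hh.1, zero_add, bd_nilOp_pow_apply, h1, pow_succ,
      Module.End.mul_apply, nilOp_eq_zero_of_degree_zero p h0, map_zero]
  exact one_ne_zero (congrFun h2 [])

end Tower

section Filling

open scoped Pointwise

variable {k E : Type*} [Field k] [DecidableEq E]

/-- The part of a chain supported on a single face. -/
def face (A : Finset E) : (List E → k) →ₗ[k] (List E → k) := diag fun B => if B = A then 1 else 0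

lemma face_apply (A : Finset E) (f : List E → k) (l : List E) :
    face A f l = if l.toFinset = A then f l else 0 := by
  rw [face, diag_apply, ite_mul, one_mul, zero_mul]

lemma face_mem {𝓕 𝓖 : Set (Finset E)} {n : ℕ} {A : Finset E} {f : List E → k}
    (hf : f ∈ Chain k 𝓕 n) (hA : A ∈ 𝓕 → A ∈ 𝓖) : face A f ∈ Chain k 𝓖 n := by
  refine diag_mem _ hf fun B hB h => ?_
  by_cases hBA : B = A
  · exact hBA ▸ hA (hBA ▸ hB)
  · simp [hBA] at h

lemma face_eq_zero {𝓕 : Set (Finset E)} {n : ℕ} {A : Finset E} {f : List E → k}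
    (hf : f ∈ Chain k 𝓕 n) (hA : A ∉ 𝓕) : face A f = 0 := by
  funext l
  rw [face_apply]
  split_ifs with h
  · by_contra hl
    exact hA (h ▸ (hf.2 l hl).2)
  · rfl

variable [Fintype E]

lemma sum_face (f : List E → k) : ∑ A, face A f = f := by
  funext l
  rw [Finset.sum_apply]
  simp [face_apply]

lemma bd_eq_zero_of_degree_zero {𝓕 : Set (Finset E)} {f : List E → k} (hf : f ∈ Chain k 𝓕 0) :
    bd f = 0 := by
  funext l
  rw [bd_apply]
  refine Finset.sum_eq_zero fun e _ => ?_
  by_contra h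
  simpa using (hf.2 _ h).1

open scoped Classical in
/-- The chain map that is the identity on faces in `L` and fills in the other faces by coning. -/
noncomputable def fill (L : Set (Finset E)) (s : Finset E → E) :
    ℕ → (List E → k) →ₗ[k] (List E → k)
  | 0 => LinearMap.id
  | n + 1 => ∑ A, if A ∈ L then face A else cone (s A) ∘ₗ fill L s n ∘ₗ bd ∘ₗ face A

variable {K L : Set (Finset E)} {s : Finset E → E}

open scoped Classical in
lemma fill_succ (n : ℕ) (f : List E → k) : fill L s (n + 1) f =
    ∑ A, if A ∈ L then face A f else cone (s A) (fill L s n (bd (face A f))) := by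
  rw [fill, LinearMap.sum_apply]
  refine Finset.sum_congr rfl fun A _ => ?_
  split_ifs <;> rfl

lemma fill_eq_self {n : ℕ} {f : List E → k} (hf : f ∈ Chain k L n) : fill L s n f = f := by
  cases n with
  | zero => rfl
  | succ n =>
    rw [fill_succ]
    conv_rhs => rw [← sum_face f]
    refine Finset.sum_congr rfl fun A _ => ?_
    split_ifs with hA
    · rfl
    · rw [face_eq_zero hf hA, map_zero, map_zero, map_zero]

lemma bd_fill (hK : ∀ A ∈ K, ∀ B ⊆ A, B ∈ K) (hL : ∀ A ∈ L, ∀ B ⊆ A, B ∈ L) (n : ℕ) :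
    ∀ f ∈ Chain k K (n + 1), bd (fill L s (n + 1) f) = fill L s n (bd f) := by
  induction n with
  | zero =>
    intro f hf
    rw [fill_succ, map_sum]
    conv_rhs => rw [← sum_face f, map_sum, map_sum]
    refine Finset.sum_congr rfl fun A _ => ?_
    have hb : bd (face A f) ∈ Chain k Set.univ 0 :=
      bd_mem (face_mem hf id) fun _ _ _ => Set.mem_univ _
    split_ifs with hA
    · rfl
    · rw [bd_cone]
      change bd (face A f) - cone (s A) (bd (bd (face A f))) = _
      rw [bd_eq_zero_of_degree_zero hb, map_zero, sub_zero]
      rfl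
  | succ n ih =>
    intro f hf
    rw [fill_succ, map_sum]
    conv_rhs => rw [← sum_face f, map_sum, map_sum]
    refine Finset.sum_congr rfl fun A _ => ?_
    split_ifs with hA
    · have hb : bd (face A f) ∈ Chain k L (n + 1) :=
        bd_mem (𝓕 := L) (face_mem hf fun _ => hA) fun e A h =>
          hL _ h _ (Finset.subset_insert _ _)
      rw [fill_eq_self hb]
    · have hb : bd (face A f) ∈ Chain k K (n + 1) :=
        bd_mem (𝓕 := K) (face_mem hf id) fun e A h => hK _ h _ (Finset.subset_insert _ _)
      rw [bd_cone, ih _ hb, bd_bd (face_mem (𝓖 := K) hf id).1, map_zero, map_zero, sub_zero]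

lemma fill_mem {P : Finset E → Set (Finset E)} (hP : ∀ A B, B ⊆ A → P B ⊆ P A)
    (hK : ∀ A ∈ K, ∀ B ⊆ A, B ∈ K) (h0 : ∅ ∈ L) (hPL : ∀ A ∈ L, A ∈ P A)
    (hPs : ∀ A ∈ K, A ∉ L → ∀ B ∈ P A, insert (s A) B ∈ P A) (n : ℕ) :
    ∀ (X : Set (Finset E)), ∀ f ∈ Chain k {A | A ∈ K ∧ P A ⊆ X} n, fill L s n f ∈ Chain k X n := by
  induction n with
  | zero =>
    intro X f hf
    refine ⟨hf.1, fun l hl => ⟨(hf.2 l hl).1, ?_⟩⟩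
    have h1 := card_of_ne_zero hf hl
    have h2 := (hf.2 l hl).2.2
    rw [Finset.card_eq_zero.1 h1] at h2 ⊢
    exact h2 (hPL _ h0)
  | succ n ih =>
    intro X f hf
    rw [fill_succ]
    refine Submodule.sum_mem _ fun A _ => ?_
    by_cases hAX : A ∈ {A | A ∈ K ∧ P A ⊆ X}
    · split_ifs with hA
      · exact face_mem hf fun _ => hAX.2 (hPL A hA)
      · have h1 : bd (face A f) ∈ Chain k {B | B ∈ K ∧ P B ⊆ P A} n :=
          bd_mem (𝓕 := {B | B ⊆ A}) (face_mem hf fun _ => Finset.Subset.refl A) fun e B hB =>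
            ⟨hK A hAX.1 B ((Finset.subset_insert _ _).trans hB),
              hP A B ((Finset.subset_insert _ _).trans hB)⟩
        exact chain_mono hAX.2 (cone_mem (s A) (ih _ _ h1) (hPs A hAX.1 hA))
    · rw [face_eq_zero hf hAX]
      simp

end Filling

section FillingEquivariant

open scoped Pointwise

variable {F E : Type*} [Field F] [AddAction F E] [DecidableEq E]

lemma translate_cone (g : F) (w : E) (f : List E → F) :
    translate g (cone w f) = cone (g +ᵥ w) (translate g f) := by
  funext l
  rw [translate_apply]
  induction l generalizing f with
  | nil => rfl
  | cons e l ih =>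
    rw [List.map_cons, cone_cons, cone_cons, translate_apply, ih]
    congr 2
    rw [neg_vadd_eq_iff]

lemma translate_face (g : F) (A : Finset E) (f : List E → F) :
    translate g (face A f) = face (g +ᵥ A) (translate g f) := by
  funext l
  rw [translate_apply, face_apply, face_apply, translate_apply, toFinset_map_vadd]
  exact if_congr neg_vadd_eq_iff rfl rfl

variable [Fintype E] {K L : Set (Finset E)} {s : Finset E → E}

lemma fill_translate (hK : ∀ A ∈ K, ∀ B ⊆ A, B ∈ K) (hL : ∀ (g : F), ∀ A ∈ L, g +ᵥ A ∈ L)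
    (hs : ∀ (g : F), ∀ A ∈ K, A ∉ L → s (g +ᵥ A) = g +ᵥ s A) (g : F) (n : ℕ) :
    ∀ f ∈ Chain F K n, fill L s n (translate g f) = translate g (fill L s n f) := by
  induction n with
  | zero => exact fun f _ => rfl
  | succ n ih =>
    intro f hf
    rw [fill_succ, fill_succ, map_sum, ← Equiv.sum_comp (AddAction.toPerm g)]
    refine Finset.sum_congr rfl fun A _ => ?_
    rw [AddAction.toPerm_apply, ← translate_face]
    have hLA : g +ᵥ A ∈ L ↔ A ∈ L :=
      ⟨fun h => by simpa using hL (-g) _ h, hL g A⟩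
    by_cases hA : A ∈ L
    · rw [if_pos hA, if_pos (hLA.2 hA)]
    · rw [if_neg hA, if_neg fun h => hA (hLA.1 h)]
      by_cases hAK : A ∈ K
      · have hb : bd (face A f) ∈ Chain F K n :=
          bd_mem (𝓕 := K) (face_mem hf id) fun e A h => hK _ h _ (Finset.subset_insert _ _)
        rw [bd_translate, ih _ hb, hs g A hAK hA, translate_cone]
      · rw [face_eq_zero hf hAK]
        simp

lemma fill_nilOp_pow [Fintype F] (p : ℕ) [Fact p.Prime] [Algebra (ZMod p) F]
    (hK : ∀ A ∈ K, ∀ B ⊆ A, B ∈ K) (hKg : ∀ (g : F), ∀ A ∈ K, g +ᵥ A ∈ K)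
    (hL : ∀ (g : F), ∀ A ∈ L, g +ᵥ A ∈ L)
    (hs : ∀ (g : F), ∀ A ∈ K, A ∉ L → s (g +ᵥ A) = g +ᵥ s A) (n a : ℕ) :
    ∀ f ∈ Chain F K n,
      fill L s n ((nilOp F E p ^ a) f) = (nilOp F E p ^ a) (fill L s n f) := by
  induction a with
  | zero => exact fun f _ => rfl
  | succ a ih =>
    intro f hf
    have h1 : nilOp F E p f ∈ Chain F K n := by simpa using nilOp_pow_mem p hKg hf 1
    rw [pow_succ, Module.End.mul_apply, Module.End.mul_apply, ih _ h1]
    congr 1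
    rw [nilOp_apply, nilOp_apply, map_sum]
    refine Finset.sum_congr rfl fun i _ => ?_
    rw [map_smul, map_sub, fill_translate hK hL hs _ n f hf]

end FillingEquivariant

/-! ### Partial colorings -/

section Coloring

open scoped Pointwise

/-- Translations act on colored points by translating the color. -/
instance coloredPointAction (ι F : Type*) [Field F] : AddAction F (Option ι × F) where
  vadd g e := (e.1, g + e.2)
  zero_vadd e := Prod.ext rfl (zero_add e.2)
  add_vadd g h e := Prod.ext rfl (add_assoc g h e.2)

lemma isAlt_emptyChain (F E : Type*) [Field F] : IsAlt (emptyChain F E) := by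
  intro l a b l'
  simp [emptyChain]

variable {F : Type*}

lemma vadd_fst {ι : Type*} [Field F] (g : F) (e : Option ι × F) : (g +ᵥ e).1 = e.1 := rfl

lemma vadd_snd {ι : Type*} [Field F] (g : F) (e : Option ι × F) : (g +ᵥ e).2 = g + e.2 := rfl

/-- The partial colorings: no point receives two colors and the extra point receives none. -/
def partialColorings (ι F : Type*) : Set (Finset (Option ι × F)) :=
  {A | ∀ e ∈ A, e.1 ≠ none ∧ ∀ e' ∈ A, e.1 = e'.1 → e = e'}

lemma partialColorings_mono {ι : Type*} : ∀ A ∈ partialColorings ι F, ∀ B ⊆ A,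
    B ∈ partialColorings ι F :=
  fun _ hA _ hB e he => ⟨(hA e (hB he)).1, fun e' he' => (hA e (hB he)).2 e' (hB he')⟩

variable [DecidableEq F]

/-- The part of a given color of a partial coloring. -/
def colorClass {ι : Type*} (A : Finset (Option ι × F)) (c : F) : Finset (Option ι × F) :=
  A.filter fun e => e.2 = c

lemma colorClass_mono {ι : Type*} {A B : Finset (Option ι × F)} (h : A ⊆ B) (c : F) :
    colorClass A c ⊆ colorClass B c := Finset.filter_subset_filter _ h

/-- The partial colorings with small color classes. -/
def smallColorings (ι F : Type*) [DecidableEq F] (m : ℕ) : Set (Finset (Option ι × F)) :=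
  {A | A ∈ partialColorings ι F ∧ ∀ c, (colorClass A c).card ≤ m}

lemma smallColorings_mono {ι : Type*} {m : ℕ} : ∀ A ∈ smallColorings ι F m, ∀ B ⊆ A,
    B ∈ smallColorings ι F m :=
  fun A hA B hB => ⟨partialColorings_mono A hA.1 B hB,
    fun c => (Finset.card_le_card (colorClass_mono hB c)).trans (hA.2 c)⟩

lemma mem_vadd_iff {ι : Type*} [Field F] [DecidableEq ι] (g : F) (A : Finset (Option ι × F))
    (e : Option ι × F) : e ∈ g +ᵥ A ↔ -g +ᵥ e ∈ A := Finset.neg_vadd_mem_iff.symm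

lemma vadd_mem_partialColorings {ι : Type*} [Field F] [DecidableEq ι] (g : F) :
    ∀ A ∈ partialColorings ι F, g +ᵥ A ∈ partialColorings ι F := by
  intro A hA e he
  rw [mem_vadd_iff] at he
  refine ⟨(hA _ he).1, fun e' he' hee' => ?_⟩
  rw [mem_vadd_iff] at he'
  exact AddAction.injective (-g) ((hA _ he).2 _ he' hee')

lemma colorClass_vadd {ι : Type*} [Field F] [DecidableEq ι] (g : F) (A : Finset (Option ι × F)) (c : F) :
    colorClass (g +ᵥ A) (g + c) = g +ᵥ colorClass A c := by
  ext e
  rw [mem_vadd_iff, colorClass, colorClass, Finset.mem_filter, Finset.mem_filter, mem_vadd_iff,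
    vadd_snd, neg_add_eq_iff_eq_add]

lemma vadd_mem_smallColorings {ι : Type*} [Field F] [DecidableEq ι] {m : ℕ} (g : F) :
    ∀ A ∈ smallColorings ι F m, g +ᵥ A ∈ smallColorings ι F m := by
  refine fun A hA => ⟨vadd_mem_partialColorings g A hA.1, fun c => ?_⟩
  have := colorClass_vadd g A (-g + c)
  rw [add_neg_cancel_left] at this
  rw [this, Finset.card_vadd_finset]
  exact hA.2 _

variable [Fintype F] {M : ℕ}

/-- The colors used too often. -/
def bigColors {ι : Type*} (m : ℕ) (A : Finset (Option ι × F)) : Finset F :=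
  Finset.univ.filter fun c => m < (colorClass A c).card

lemma mem_bigColors {ι : Type*} {m : ℕ} {A : Finset (Option ι × F)} {c : F} :
    c ∈ bigColors m A ↔ m < (colorClass A c).card := by
  simp [bigColors]

lemma bigColors_mono {ι : Type*} {m : ℕ} {A B : Finset (Option ι × F)} (h : A ⊆ B) :
    bigColors m A ⊆ bigColors m B := fun c hc =>
  mem_bigColors.2 ((mem_bigColors.1 hc).trans_le (Finset.card_le_card (colorClass_mono h c)))

lemma vadd_mem_bigColors {ι : Type*} [Field F] [DecidableEq ι] {m : ℕ} (g : F)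
    {A : Finset (Option ι × F)} {c : F} : g + c ∈ bigColors m (g +ᵥ A) ↔ c ∈ bigColors m A := by
  rw [mem_bigColors, mem_bigColors, colorClass_vadd, Finset.card_vadd_finset]

lemma bigColors_ne_univ {m : ℕ} (hm : M < Fintype.card F * (m + 1))
    {A : Finset (Option (Fin M) × F)} (hA : A ∈ partialColorings (Fin M) F) :
    bigColors m A ≠ Finset.univ := by
  intro h
  have h1 : A.card ≤ M := by
    have h2 := Finset.card_le_card_of_injOn (s := A) (t := Finset.univ.erase none) Prod.fst
      (fun e he => by simpa using (hA e he).1) fun e he e' he' hee' => (hA e he).2 e' he' hee'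
    rwa [Finset.card_erase_of_mem (Finset.mem_univ _), Finset.card_univ, Fintype.card_option,
      Fintype.card_fin, Nat.add_sub_cancel] at h2
  have h2 : A.card = ∑ c, (colorClass A c).card :=
    Finset.card_eq_sum_card_fiberwise fun _ _ => Finset.mem_univ _
  have h3 : ∑ _c : F, (m + 1) ≤ ∑ c, (colorClass A c).card :=
    Finset.sum_le_sum fun c _ => mem_bigColors.1 (h ▸ Finset.mem_univ c)
  rw [Finset.sum_const, Finset.card_univ, smul_eq_mul] at h3
  omega

/-- The position of a colored point. -/
def rank (e : Option (Fin M) × F) : ℕ := e.1.elim 0 Fin.val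

/-- The color of the first point whose color is used too often. -/
def IsFirstBigColor (m : ℕ) (A : Finset (Option (Fin M) × F)) (c : F) : Prop :=
  c ∈ bigColors m A ∧ ∃ e ∈ A, e.2 = c ∧ ∀ e' ∈ A, e'.2 ∈ bigColors m A → rank e ≤ rank e'

lemma exists_isFirstBigColor {m : ℕ} {A : Finset (Option (Fin M) × F)}
    (hA : A ∈ partialColorings (Fin M) F) (hA' : A ∉ smallColorings (Fin M) F m) :
    ∃ c, IsFirstBigColor m A c := by
  have h1 : ∃ c, m < (colorClass A c).card := by
    by_contra! h
    exact hA' ⟨hA, h⟩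
  obtain ⟨c, hc⟩ := h1
  obtain ⟨e, he⟩ := Finset.card_pos.1 (lt_of_le_of_lt (Nat.zero_le m) hc)
  rw [colorClass, Finset.mem_filter] at he
  obtain ⟨e0, he0, hmin⟩ := Finset.exists_min_image (A.filter fun e => e.2 ∈ bigColors m A) rank
    ⟨e, Finset.mem_filter.2 ⟨he.1, by rw [he.2]; exact mem_bigColors.2 hc⟩⟩
  rw [Finset.mem_filter] at he0
  exact ⟨e0.2, he0.2, e0, he0.1, rfl, fun e' he' h => hmin e' (Finset.mem_filter.2 ⟨he', h⟩)⟩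

lemma IsFirstBigColor.unique {m : ℕ} {A : Finset (Option (Fin M) × F)}
    (hA : A ∈ partialColorings (Fin M) F) {c c' : F} (hc : IsFirstBigColor m A c)
    (hc' : IsFirstBigColor m A c') : c = c' := by
  obtain ⟨h1, ⟨v, x⟩, he, rfl, h2⟩ := hc
  obtain ⟨h1', ⟨v', x'⟩, he', rfl, h2'⟩ := hc'
  have h3 := le_antisymm (h2 _ he' h1') (h2' _ he h1)
  have h4 := (hA _ he).1
  have h5 := (hA _ he').1
  obtain ⟨i, rfl⟩ := Option.ne_none_iff_exists'.1 h4
  obtain ⟨i', rfl⟩ := Option.ne_none_iff_exists'.1 h5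
  have h6 : i = i' := Fin.ext h3
  exact congrArg Prod.snd ((hA _ he).2 _ he' (congrArg some h6))

lemma IsFirstBigColor.vadd [Field F] {m : ℕ} {A : Finset (Option (Fin M) × F)} {c : F}
    (hc : IsFirstBigColor m A c) (g : F) : IsFirstBigColor m (g +ᵥ A) (g + c) := by
  obtain ⟨h1, e, he, rfl, h2⟩ := hc
  refine ⟨(vadd_mem_bigColors g).2 h1, g +ᵥ e, Finset.vadd_mem_vadd_finset he, rfl,
    fun e' he' hb => ?_⟩
  rw [mem_vadd_iff] at he'
  refine h2 (-g +ᵥ e') he' ?_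
  rwa [vadd_snd, ← vadd_mem_bigColors g, add_neg_cancel_left]

open scoped Classical in
/-- The apex used to fill in a partial coloring. -/
noncomputable def apex [Zero F] (m : ℕ) (A : Finset (Option (Fin M) × F)) : Option (Fin M) × F :=
  (none, if h : ∃ c, IsFirstBigColor m A c then h.choose else 0)

lemma apex_eq [Zero F] {m : ℕ} {A : Finset (Option (Fin M) × F)}
    (hA : A ∈ partialColorings (Fin M) F) {c : F} (hc : IsFirstBigColor m A c) : apex m A = (none, c) := by
  have h : ∃ c, IsFirstBigColor m A c := ⟨c, hc⟩
  rw [apex, dif_pos h, h.choose_spec.unique hA hc]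

/-- The faces used to fill in a partial coloring. -/
def fillingFaces (m : ℕ) (A : Finset (Option (Fin M) × F)) : Set (Finset (Option (Fin M) × F)) :=
  {C | ∃ B ⊆ A, B ∈ smallColorings (Fin M) F m ∧ ∃ T ⊆ bigColors m A,
    C = B ∪ T.image fun c => (none, c)}

lemma exists_tower_partialColorings [Field F] (p : ℕ) [Fact p.Prime] [Algebra (ZMod p) F]
    [CharP F p] (M : ℕ) (a : ℕ → ℕ) (ha0 : ∀ i, 0 < a i)
    (hap : ∀ i, a i + a (i + 1) = p) : ∃ c : ℕ → List (Option (Fin M) × F) → F,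
      c 0 = emptyChain F (Option (Fin M) × F) ∧
      (∀ i ≤ M, c i ∈ Chain F (partialColorings (Fin M) F) i) ∧ bd (c 1) = c 0 ∧
      ∀ i, 0 < i → bd (c (i + 1)) = (nilOp F (Option (Fin M) × F) p ^ a i) (c i) := by
  set u := nilOp F (Option (Fin M) × F) p with hu
  let w : ℕ → Option (Fin M) × F := fun i => if h : i < M then (some ⟨i, h⟩, 0) else (none, 0)
  let K : ℕ → Set (Finset (Option (Fin M) × F)) := fun i =>
    {A | A ∈ partialColorings (Fin M) F ∧ ∀ e ∈ A, rank e < i}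
  let a' : ℕ → ℕ := fun i => if i = 0 then 0 else a i
  let c : ℕ → List (Option (Fin M) × F) → F := fun i =>
    Nat.rec (emptyChain F _) (fun i f => cone (w i) ((u ^ a' i) f)) i
  have hc : ∀ i, c (i + 1) = cone (w i) ((u ^ a' i) (c i)) := fun _ => rfl
  have hK : ∀ i (g : F), ∀ A ∈ K i, g +ᵥ A ∈ K i := fun i g A hA =>
    ⟨vadd_mem_partialColorings g A hA.1, fun e he =>
      hA.2 (-g +ᵥ e) ((mem_vadd_iff _ _ _).1 he)⟩
  have hc0 : c 0 ∈ Chain F (K 0) 0 := by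
    refine ⟨isAlt_emptyChain F _, fun l hl => ?_⟩
    have : l = [] := by
      by_contra h
      exact hl (by simp [c, emptyChain, h])
    subst this
    exact ⟨rfl, fun e he => by simp at he, fun e he => by simp at he⟩
  have hmem : ∀ i ≤ M, c i ∈ Chain F (K i) i := by
    intro i
    induction i with
    | zero => exact fun _ => hc0
    | succ i ih =>
      intro hi
      rw [hc]
      refine cone_mem _ (nilOp_pow_mem p (hK i) (ih (by omega)) _) fun A hA => ?_
      have hwi : w i = (some ⟨i, hi⟩, 0) := dif_pos hi
      rw [hwi]
      have hne : ∀ e ∈ A, e.1 ≠ some ⟨i, hi⟩ := by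
        intro e he h
        have := hA.2 e he
        rw [rank, h] at this
        exact lt_irrefl _ this
      refine ⟨fun e he => ?_, fun e he => ?_⟩
      · rcases Finset.mem_insert.1 he with rfl | he
        · refine ⟨by simp, fun e' he' hee' => ?_⟩
          rcases Finset.mem_insert.1 he' with rfl | he'
          · rfl
          · exact absurd hee'.symm (hne e' he')
        · refine ⟨(hA.1 e he).1, fun e' he' hee' => ?_⟩
          rcases Finset.mem_insert.1 he' with rfl | he'
          · exact absurd hee' (hne e he)
          · exact (hA.1 e he).2 e' he' hee'
      · rcases Finset.mem_insert.1 he with rfl | he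
        · exact Nat.lt_succ_self i
        · exact (hA.2 e he).trans (Nat.lt_succ_self i)
  have hbd : ∀ i, bd (c (i + 1)) = (u ^ a' i) (c i) ∧ (u ^ a' i) (bd (c i)) = 0 := by
    intro i
    have key : (u ^ a' i) (bd (c i)) = 0 → bd (c (i + 1)) = (u ^ a' i) (c i) := by
      intro h
      rw [hc, bd_cone, bd_nilOp_pow_apply, h, map_zero, sub_zero]
    induction i with
    | zero =>
      have h : (u ^ a' 0) (bd (c 0)) = 0 := by rw [bd_eq_zero_of_degree_zero hc0, map_zero]
      exact ⟨key h, h⟩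
    | succ i ih =>
      have h : (u ^ a' (i + 1)) (bd (c (i + 1))) = 0 := by
        rw [(ih fun h => by rw [hc, bd_cone, bd_nilOp_pow_apply, h, map_zero, sub_zero]).1]
        rcases i with - | i
        · obtain ⟨n, hn⟩ : ∃ n, a 1 = n + 1 := ⟨a 1 - 1, by have := ha0 1; omega⟩
          simp only [a', zero_add, one_ne_zero, if_false, if_true, pow_zero, hn]
          rw [pow_succ]
          have h0 : u (c 0) = 0 := nilOp_eq_zero_of_degree_zero p hc0
          change (u ^ n) (u (c 0)) = 0
          rw [h0, map_zero]
        · rw [← Module.End.mul_apply, ← pow_add]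
          simp only [a', Nat.succ_ne_zero, if_false]
          rw [add_comm, hap, hu, nilOp_pow_char, LinearMap.zero_apply]
      exact ⟨key h, h⟩
  refine ⟨c, rfl, fun i hi => chain_mono (fun A hA => hA.1) (hmem i hi), ?_, fun i hi => ?_⟩
  · exact (hbd 0).1
  · rw [(hbd i).1]
    simp only [a', hi.ne', if_false]

/-- An invariant complex without invariant faces that contains the joins of all small colorings
with all proper sets of copies of the extra point cannot have vanishing homology above degree
`N`, if there are `N + 1` points to color. -/
theorem false_of_smallColorings_subset [Field F] (p : ℕ) [Fact p.Prime] [Algebra (ZMod p) F]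
    [CharP F p] {N m : ℕ} (hN0 : 0 < N)
    (hm : N + 1 < Fintype.card F * (m + 1)) {D : Set (Finset (Option (Fin (N + 1)) × F))}
    (hD : ∀ (g : F), ∀ A ∈ D, g +ᵥ A ∈ D)
    (hdown : ∀ A ∈ D, ∀ B ⊆ A, B ∈ D) (hfix : ∀ A ∈ D, A.Nonempty → ∃ g : F, g +ᵥ A ≠ A)
    (hN : AcyclicAbove F D N)
    (h : ∀ A ∈ smallColorings (Fin (N + 1)) F m, ∀ T : Finset F, T ≠ Finset.univ →
      A ∪ T.image (fun c => (none, c)) ∈ D) : False := by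
  have hp := (Fact.out : p.Prime).two_le
  let a : ℕ → ℕ := fun i => if Even i then 1 else p - 1
  have ha0 : ∀ i, 0 < a i := by
    intro i
    simp only [a]
    split_ifs <;> omega
  have hap : ∀ i, a i + a (i + 1) = p := by
    intro i
    simp only [a, Nat.even_add_one]
    by_cases hi : Even i <;> simp [hi] <;> omega
  obtain ⟨c, hc0, hc, hc1, hcbd⟩ :=
    exists_tower_partialColorings (F := F) p (N + 1) a ha0 hap
  set K := partialColorings (Fin (N + 1)) F with hK
  set L := smallColorings (Fin (N + 1)) F m with hL
  have hs : ∀ (g : F), ∀ A ∈ K, A ∉ L → apex m (g +ᵥ A) = g +ᵥ apex m A := by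
    intro g A hA hA'
    obtain ⟨x, hx⟩ := exists_isFirstBigColor hA hA'
    rw [apex_eq hA hx, apex_eq (vadd_mem_partialColorings g A hA) (hx.vadd g)]
    rfl
  have h0 : ∅ ∈ L := ⟨fun e he => by simp at he, fun c => by simp [colorClass]⟩
  have hPD : ∀ A ∈ K, fillingFaces m A ⊆ D := by
    rintro A hA C ⟨B, hB, hBL, T, hT, rfl⟩
    refine h B hBL T fun hTu => bigColors_ne_univ hm hA ?_
    rwa [hTu, Finset.univ_subset_iff] at hT
  have hPs : ∀ A ∈ K, A ∉ L → ∀ B ∈ fillingFaces m A, insert (apex m A) B ∈ fillingFaces m A := by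
    rintro A hA hA' C ⟨B, hB, hBL, T, hT, rfl⟩
    obtain ⟨x, hx⟩ := exists_isFirstBigColor hA hA'
    refine ⟨B, hB, hBL, insert x T, Finset.insert_subset hx.1 hT, ?_⟩
    rw [apex_eq hA hx, Finset.image_insert, Finset.union_insert]
  refine false_of_tower p hD hdown hfix hN0 hN a ha0 hap (fun i => fill L (apex m) i (c i)) hc0
    (fun i hi => ?_) ?_ fun i hi0 hi => ?_
  · refine fill_mem (K := K) (P := fillingFaces m) ?_ partialColorings_mono h0 ?_ hPs i D (c i)
      (chain_mono (fun A hA => show A ∈ {A | A ∈ K ∧ fillingFaces m A ⊆ D} from ⟨hA, hPD A hA⟩)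
        (hc i hi))
    · rintro A B hBA C ⟨B', hB', hBL, T, hT, rfl⟩
      exact ⟨B', hB'.trans hBA, hBL, T, hT.trans (bigColors_mono hBA), rfl⟩
    · exact fun A hA => ⟨A, Finset.Subset.refl A, hA, ∅, Finset.empty_subset _, by simp⟩
  · rw [bd_fill partialColorings_mono smallColorings_mono 0 (c 1) (hc 1 (by omega)), hc1]
  · rw [bd_fill partialColorings_mono smallColorings_mono i _ (hc (i + 1) (by omega)),
      hcbd i hi0, fill_nilOp_pow p partialColorings_mono vadd_mem_partialColorings
        vadd_mem_smallColorings hs i _ _ (hc i (by omega))]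

end Coloring

/-! ### Balanced colorings -/

section Balanced

/-- A version of Gordan's theorem of the alternative. -/
lemma exists_linear_pos_or_exists_weights {E V : Type*} [Fintype E] [NormedAddCommGroup V]
    [NormedSpace ℝ V] [FiniteDimensional ℝ V] (P : E → V) (A : Finset E) (Q : Submodule ℝ V) :
    (∃ f : V →ₗ[ℝ] ℝ, (∀ q ∈ Q, f q = 0) ∧ ∀ e ∈ A, 0 < f (P e)) ∨
      ∃ β : E → ℝ, (∀ e, 0 ≤ β e) ∧ (∀ e ∉ A, β e = 0) ∧ ∑ e, β e = 1 ∧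
        ∑ e, β e • P e ∈ Q := by
  classical
  let Z : Submodule ℝ (E → ℝ) := ⨅ e ∈ (A : Set E)ᶜ, LinearMap.ker (LinearMap.proj e)
  have hZ : ∀ β : E → ℝ, β ∈ Z ↔ ∀ e ∉ A, β e = 0 := by
    intro β
    simp [Z]
  let L : (E → ℝ) →ₗ[ℝ] V := Fintype.linearCombination ℝ P
  have hL : ∀ β, L β = ∑ e, β e • P e := fun _ => rfl
  let C : Set V := L '' (stdSimplex ℝ E ∩ Z)
  have hC : IsCompact C := ((isCompact_stdSimplex ℝ E).inter_right
    Z.closed_of_finiteDimensional).image L.continuous_of_finiteDimensional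
  have hC' : Convex ℝ C := ((convex_stdSimplex ℝ E).inter Z.convex).linear_image L
  by_cases hdisj : Disjoint C (Q : Set V)
  · left
    obtain ⟨f, u, v, hu, huv, hv⟩ := geometric_hahn_banach_compact_closed hC' hC Q.convex
      Q.closed_of_finiteDimensional hdisj
    have hf : ∀ q ∈ Q, f q = 0 := by
      intro q hq
      by_contra hne
      have h := hv (((v - 1) / f q) • q) (Q.smul_mem _ hq)
      rw [map_smul, smul_eq_mul, div_mul_cancel₀ _ hne] at h
      linarith
    have hv0 : v < 0 := by simpa using hv 0 Q.zero_mem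
    refine ⟨-(f : V →ₗ[ℝ] ℝ), fun q hq => by simp [hf q hq], fun e he => ?_⟩
    have h1 : P e ∈ C := by
      refine ⟨Pi.single e 1, ⟨single_mem_stdSimplex ℝ e, (hZ _).2 fun e' he' => ?_⟩, ?_⟩
      · exact Pi.single_eq_of_ne (fun h : e' = e => he' (h ▸ he)) 1
      · simp [L, Fintype.linearCombination_apply_single]
    have h2 := hu _ h1
    have h3 : (-(f : V →ₗ[ℝ] ℝ)) (P e) = - f (P e) := rfl
    rw [h3]
    linarith
  · right
    obtain ⟨_, ⟨β, ⟨hβ, hβZ⟩, rfl⟩, hQ⟩ := Set.not_disjoint_iff.1 hdisj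
    exact ⟨β, hβ.1, (hZ β).1 hβZ, hβ.2, hQ⟩

variable {κ J F : Type*} [Fintype J] [Fintype F]

/-- The tensor product of the vector of a point with the unit vector of its color. -/
def tensorVec [DecidableEq F] (z : κ → J → ℝ) (e : κ × F) (x : F × J) : ℝ := if x.1 = e.2 then z e.1 x.2 else 0

lemma sum_tensorVec_mul [DecidableEq F] (z : κ → J → ℝ) (e : κ × F) (y : F × J → ℝ) :
    ∑ x, tensorVec z e x * y x = ∑ j, z e.1 j * y (e.2, j) := by
  rw [Fintype.sum_prod_type, Finset.sum_eq_single e.2]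
  · simp [tensorVec]
  · intro g _ hg
    simp [tensorVec, hg]
  · simp

/-- The sets of colored points on which some vector with zero sum over the colors is positive. -/
def balancedFaces (F : Type*) [Fintype F] (z : κ → J → ℝ) : Set (Finset (κ × F)) :=
  {B | ∃ y : F × J → ℝ, (∀ j, ∑ g, y (g, j) = 0) ∧ ∀ e ∈ B, 0 < ∑ j, z e.1 j * y (e.2, j)}

lemma balancedFaces_mono (z : κ → J → ℝ) : ∀ A ∈ balancedFaces F z, ∀ B ⊆ A,
    B ∈ balancedFaces F z :=
  fun _ ⟨y, hy, hA⟩ _ hB => ⟨y, hy, fun e he => hA e (hB he)⟩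

/-- The vectors with zero sum over the colors. -/
def zeroSum (F J : Type*) [Fintype F] : Submodule ℝ (EuclideanSpace ℝ (F × J)) where
  carrier := {y | ∀ j, ∑ g, y (g, j) = 0}
  zero_mem' j := by simp
  add_mem' {y y'} h h' j := by simp [Finset.sum_add_distrib, h j, h' j]
  smul_mem' t y h j := by simp [← Finset.mul_sum, h j]

lemma finrank_zeroSum_le [Nonempty F] :
    Module.finrank ℝ (zeroSum F J) ≤ (Fintype.card F - 1) * Fintype.card J := by
  classical
  obtain ⟨g₀⟩ := ‹Nonempty F›
  let φ : zeroSum F J →ₗ[ℝ] {g : F // g ≠ g₀} × J → ℝ :=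
    { toFun := fun y x => y.1 (x.1, x.2)
      map_add' := fun y y' => rfl
      map_smul' := fun t y => rfl }
  have hφ : Function.Injective φ := by
    rw [← LinearMap.ker_eq_bot, LinearMap.ker_eq_bot']
    intro y hy
    have h1 : ∀ g j, g ≠ g₀ → y.1 (g, j) = 0 := fun g j hg => congrFun hy (⟨g, hg⟩, j)
    refine Subtype.ext (PiLp.ext fun ⟨g, j⟩ => ?_)
    by_cases hg : g = g₀
    · have h2 := y.2 j
      rw [Finset.sum_eq_single g₀ (fun g _ hg => h1 g j hg) (by simp)] at h2
      rw [hg]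
      exact h2
    · exact h1 g j hg
  refine (LinearMap.finrank_le_finrank_of_injective hφ).trans ?_
  rw [Module.finrank_fintype_fun_eq_card, Fintype.card_prod]
  simp [Fintype.card_subtype_compl]

open scoped RealInnerProductSpace in
lemma balancedFaces_eq_posFamily [Fintype κ] [DecidableEq F] (z : κ → J → ℝ) :
    balancedFaces F z = posFamily (fun e => WithLp.toLp 2 (tensorVec z e)) (zeroSum F J)
      (Finset.univ : Finset (κ × F)) := by
  have h : ∀ (e : κ × F) (y : EuclideanSpace ℝ (F × J)),
      ⟪WithLp.toLp 2 (tensorVec z e), y⟫ = ∑ j, z e.1 j * y (e.2, j) := by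
    intro e y
    rw [← sum_tensorVec_mul z e y, PiLp.inner_apply]
    simp [mul_comm]
  ext B
  constructor
  · rintro ⟨y, hy, hB⟩
    exact ⟨Finset.subset_univ B, WithLp.toLp 2 y, hy, fun e he => by rw [h]; exact hB e he⟩
  · rintro ⟨-, y, hy, hB⟩
    exact ⟨y, hy, fun e he => by rw [← h]; exact hB e he⟩

variable [DecidableEq F]

open scoped Pointwise

lemma vadd_mem_balancedFaces [Field F] [DecidableEq κ] (z : Option κ → J → ℝ) (g : F) :
    ∀ A ∈ balancedFaces F z, g +ᵥ A ∈ balancedFaces F z := by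
  rintro A ⟨y, hy, hA⟩
  refine ⟨fun x => y (-g + x.1, x.2), fun j => ?_, fun e he => ?_⟩
  · rw [← hy j]
    exact Equiv.sum_comp (Equiv.addLeft (-g)) fun x => y (x, j)
  · exact hA (-g +ᵥ e) ((mem_vadd_iff g A e).1 he)

lemma exists_vadd_ne [Field F] [DecidableEq κ] (z : Option κ → J → ℝ) :
    ∀ A ∈ balancedFaces F z, A.Nonempty → ∃ g : F, g +ᵥ A ≠ A := by
  rintro A ⟨y, hy, hA⟩ ⟨e, he⟩
  by_contra! h
  have h1 : ∀ g : F, 0 < ∑ j, z e.1 j * y (g, j) := by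
    intro g
    have h2 := Finset.vadd_mem_vadd_finset (a := g - e.2) he
    rw [h] at h2
    have h3 := hA _ h2
    rwa [vadd_fst, vadd_snd, sub_add_cancel] at h3
  have h2 : ∑ g, ∑ j, z e.1 j * y (g, j) = 0 := by
    rw [Finset.sum_comm]
    simp [← Finset.mul_sum, hy]
  have h3 : 0 < ∑ g, ∑ j, z e.1 j * y (g, j) :=
    Finset.sum_pos (fun g _ => h1 g) ⟨0, Finset.mem_univ _⟩
  exact h3.ne' h2

/-- The vectors with an extra coordinate, together with an extra vector in its direction. -/
def extendVec {ι : Type*} (x : κ → ι → ℝ) : Option κ → Option ι → ℝ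
  | some v, some j => x v j
  | some _, none => 0
  | none, some _ => 0
  | none, none => 1

lemma union_mem_balancedFaces {ι : Type*} [Fintype ι] [DecidableEq κ] (x : κ → ι → ℝ)
    {A : Finset (Option κ × F)} (hA : ∀ e ∈ A, e.1 ≠ none) {y : F × ι → ℝ}
    (hy : ∀ j, ∑ g, y (g, j) = 0) (hyA : ∀ v c, (some v, c) ∈ A → 0 < ∑ j, x v j * y (c, j))
    {T : Finset F} (hT : T ≠ Finset.univ) :
    A ∪ T.image (fun c => (none, c)) ∈ balancedFaces F (extendVec x) := by
  obtain ⟨g₀, hg₀⟩ : ∃ g, g ∉ T := by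
    by_contra! h
    exact hT (Finset.eq_univ_iff_forall.2 h)
  refine ⟨fun e => e.2.elim (1 - if e.1 = g₀ then (Fintype.card F : ℝ) else 0)
    fun j => y (e.1, j), fun j => ?_, fun e he => ?_⟩
  · rcases j with - | j
    · simp
    · exact hy j
  · rw [Fintype.sum_option]
    rcases e with ⟨- | v, c⟩
    · have hc : c ∈ T := by
        rcases Finset.mem_union.1 he with h | h
        · exact absurd rfl (hA _ h)
        · simpa using h
      have hne : c ≠ g₀ := fun h => hg₀ (h ▸ hc)
      simp [extendVec, hne]
    · have he' : (some v, c) ∈ A := by simpa using he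
      simpa [extendVec] using hyA v c he'

/-- Among sufficiently many vectors one finds disjoint small sets, one for each color, and
nonnegative weights, not all zero, whose weighted sums agree. -/
theorem exists_disjoint_sum_smul_eq [Field F] (p : ℕ) [Fact p.Prime] [Algebra (ZMod p) F]
    [CharP F p] {ι : Type*} [Fintype ι] {N m : ℕ} (hN0 : 0 < N)
    (hN : (Fintype.card F - 1) * (Fintype.card ι + 1) ≤ N)
    (hm : N + 1 < Fintype.card F * (m + 1)) (x : Fin (N + 1) → ι → ℝ) :
    ∃ (σ : F → Finset (Fin (N + 1))) (β : Fin (N + 1) → ℝ) (Y : ι → ℝ),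
      (∀ g, (σ g).card ≤ m) ∧ (∀ g g', g ≠ g' → Disjoint (σ g) (σ g')) ∧ (∀ v, 0 ≤ β v) ∧
      ∑ g, ∑ v ∈ σ g, β v = 1 ∧ ∀ g, ∑ v ∈ σ g, β v • x v = Y := by
  by_contra! hcon
  refine false_of_smallColorings_subset (F := F) p hN0 hm
    (D := balancedFaces F (extendVec x)) (vadd_mem_balancedFaces _) (balancedFaces_mono _)
    (exists_vadd_ne _) ?_ fun A hA T hT => ?_
  · rw [balancedFaces_eq_posFamily]
    refine acyclicAbove_posFamily N _ _ (finrank_zeroSum_le.trans ?_)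
    rwa [Fintype.card_option]
  let σ : F → Finset (Fin (N + 1)) := fun g => Finset.univ.filter fun v => (some v, g) ∈ A
  have hσ : ∀ {v g}, v ∈ σ g ↔ (some v, g) ∈ A := by simp [σ]
  have hσu : ∀ {v g g'}, v ∈ σ g → v ∈ σ g' → g = g' := fun h h' =>
    congrArg Prod.snd ((hA.1 _ (hσ.1 h)).2 _ (hσ.1 h') rfl)
  let Q : Submodule ℝ (F × ι → ℝ) :=
    { carrier := {q | ∀ g g' j, q (g, j) = q (g', j)}
      zero_mem' := fun _ _ _ => rfl
      add_mem' := fun h h' g g' j => by simp [h g g' j, h' g g' j]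
      smul_mem' := fun t q h g g' j => by simp [h g g' j] }
  rcases exists_linear_pos_or_exists_weights (tensorVec x)
    (Finset.univ.filter fun e : Fin (N + 1) × F => (some e.1, e.2) ∈ A) Q with
    ⟨f, hfQ, hf⟩ | ⟨β, hβ0, hβA, hβ1, hβQ⟩
  · classical
    have hfx : ∀ w : F × ι → ℝ, f w = ∑ e, w e * f (Pi.single e 1) := by
      intro w
      conv_lhs => rw [pi_eq_sum_univ' w]
      rw [map_sum]
      exact Finset.sum_congr rfl fun e _ => by rw [map_smul, smul_eq_mul]
    refine union_mem_balancedFaces x (fun e he => (hA.1 e he).1)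
      (y := fun e => f (Pi.single e 1)) (fun j => ?_) (fun v c hv => ?_) hT
    · rw [← hfQ (fun e => if e.2 = j then 1 else 0) fun _ _ _ => rfl, hfx,
        Fintype.sum_prod_type]
      simp
    · rw [← sum_tensorVec_mul x (v, c) fun e => f (Pi.single e 1), ← hfx]
      exact hf _ (by simpa using hv)
  · exfalso
    have hβσ : ∀ v g, v ∉ σ g → β (v, g) = 0 := fun v g h => hβA _ (by simpa [hσ] using h)
    have hβ : ∀ g, ∀ v ∈ σ g, ∑ g', β (v, g') = β (v, g) := fun g v hv =>
      Finset.sum_eq_single g (fun g' _ hg' => hβσ v g' fun h => hg' (hσu h hv)) (by simp)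
    have hsum : ∀ (g : F) (w : Fin (N + 1) → ℝ),
        ∑ v ∈ σ g, (∑ g', β (v, g')) * w v = ∑ v, β (v, g) * w v := by
      intro g w
      rw [Finset.sum_congr rfl fun v hv => by rw [hβ g v hv]]
      exact Finset.sum_subset (Finset.subset_univ _) fun v _ hv => by rw [hβσ v g hv, zero_mul]
    have hQ : ∀ g j, (∑ e, β e • tensorVec x e) (g, j) = ∑ v, β (v, g) * x v j := by
      intro g j
      rw [Finset.sum_apply, Fintype.sum_prod_type]
      refine Finset.sum_congr rfl fun v _ => ?_
      simp [tensorVec]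
    have hcard : ∀ g, (σ g).card ≤ m := by
      intro g
      refine le_trans ?_ (hA.2 g)
      refine Finset.card_le_card_of_injOn (fun v => (some v, g)) (fun v hv => ?_) ?_
      · simpa [colorClass] using hσ.1 hv
      · intro v _ v' _ h
        exact Option.some_injective _ (congrArg Prod.fst h)
    have hone : ∑ g, ∑ v ∈ σ g, ∑ g', β (v, g') = 1 := by
      rw [← hβ1, Fintype.sum_prod_type_right]
      exact Finset.sum_congr rfl fun g _ => by simpa using hsum g 1
    obtain ⟨g, hg⟩ := hcon σ (fun v => ∑ g, β (v, g)) (fun j => ∑ v, β (v, 0) * x v j) hcard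
      (fun g g' hgg' => Finset.disjoint_left.2 fun v hv hv' => hgg' (hσu hv hv'))
      (fun v => Finset.sum_nonneg fun g _ => hβ0 _) hone
    refine hg (funext fun j => ?_)
    rw [Finset.sum_apply]
    simp only [Pi.smul_apply, smul_eq_mul]
    rw [hsum g fun v => x v j, ← hQ, ← hQ]
    exact hβQ _ _ _

end Balanced

/-! ### Changing signs -/

section Signs

/-- The sign of a vertex: minus one on the given face and one outside. -/
def faceSign {κ : Type*} [DecidableEq κ] (μ : Finset κ) (v : κ) : ℝ := if v ∈ μ then -1 else 1

/-- The vector `(a v, 1)`, with the opposite sign if `v` lies in the given face. -/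
def signedVec {κ : Type*} [DecidableEq κ] {d : ℕ} (a : κ → EuclideanSpace ℝ (Fin d))
    (μ : Finset κ) (v : κ) : Option (Fin d) → ℝ :=
  fun j => faceSign μ v * j.elim 1 (a v)

lemma exists_linear_pos_signedVec {κ : Type*} [Fintype κ] [DecidableEq κ] {d : ℕ}
    (a : κ → EuclideanSpace ℝ (Fin d)) (μ : Finset κ)
    (hsep : convexHull ℝ (a '' ↑μ) ∩ convexHull ℝ (a '' ↑μᶜ) = ∅) :
    ∃ f : (Option (Fin d) → ℝ) →ₗ[ℝ] ℝ, ∀ v, 0 < f (signedVec a μ v) := by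
  rcases exists_linear_pos_or_exists_weights (signedVec a μ) Finset.univ ⊥ with
    ⟨f, -, hf⟩ | ⟨β, hβ0, -, hβ1, hβ⟩
  · exact ⟨f, fun v => hf v (Finset.mem_univ v)⟩
  exfalso
  have hsplit : ∀ w : κ → ℝ,
      ∑ v, β v * (faceSign μ v * w v) = ∑ v ∈ μᶜ, β v * w v - ∑ v ∈ μ, β v * w v := by
    intro w
    rw [← Finset.sum_add_sum_compl μ, add_comm, sub_eq_add_neg, ← Finset.sum_neg_distrib]
    congr 1 <;> refine Finset.sum_congr rfl fun v hv => ?_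
    · rw [faceSign, if_neg (Finset.mem_compl.1 hv), one_mul]
    · rw [faceSign, if_pos hv]
      ring
  have hcoord : ∀ j : Option (Fin d), ∑ v ∈ μᶜ, β v * j.elim 1 (a v) =
      ∑ v ∈ μ, β v * j.elim 1 (a v) := by
    intro j
    rw [← sub_eq_zero, ← hsplit]
    have h := congrFun ((Submodule.mem_bot ℝ).1 hβ) j
    rw [Finset.sum_apply] at h
    exact h
  have hw : ∑ v ∈ μᶜ, β v = ∑ v ∈ μ, β v := by simpa using hcoord none
  have hpos : 0 < ∑ v ∈ μ, β v := by
    have h := Finset.sum_add_sum_compl μ β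
    rw [hw, hβ1] at h
    linarith
  have hcenter : μᶜ.centerMass β a = μ.centerMass β a := by
    rw [Finset.centerMass, Finset.centerMass, hw]
    congr 1
    ext j
    simpa using hcoord (some j)
  refine Set.eq_empty_iff_forall_notMem.1 hsep (μ.centerMass β a) ⟨?_, ?_⟩
  · exact Finset.centerMass_mem_convexHull μ (fun v _ => hβ0 v) hpos
      fun v hv => Set.mem_image_of_mem a hv
  · rw [← hcenter]
    exact Finset.centerMass_mem_convexHull μᶜ (fun v _ => hβ0 v) (hw ▸ hpos)
      fun v hv => Set.mem_image_of_mem a hv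

/-- Affinely dependent small disjoint faces, indexed by a finite field, whose coefficients are
nonpositive on a given face and nonnegative outside. -/
theorem exists_faces_of_field {F : Type*} [Field F] [Fintype F] (p : ℕ) [Fact p.Prime]
    [Algebra (ZMod p) F] [CharP F p] {d N m : ℕ} (hN0 : 0 < N)
    (hN : (Fintype.card F - 1) * (d + 2) ≤ N) (hm : N + 1 < Fintype.card F * (m + 1))
    (a : Fin (N + 1) → EuclideanSpace ℝ (Fin d)) (μ : Finset (Fin (N + 1)))
    (hμ : μ.card < Fintype.card F)
    (hsep : convexHull ℝ (a '' ↑μ) ∩ convexHull ℝ (a '' ↑μᶜ) = ∅) :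
    ∃ (σ : F → Finset (Fin (N + 1))) (b : EuclideanSpace ℝ (Fin d)) (α : Fin (N + 1) → ℝ),
      (∀ g, (σ g).Nonempty) ∧ (∀ g, (σ g).card ≤ m) ∧
      (∀ g g', g ≠ g' → Disjoint (σ g) (σ g')) ∧ (∀ g, ∑ v ∈ σ g, α v • a v = b) ∧
      (∀ g, ∑ v ∈ σ g, α v = 1) ∧ ∀ v, (v ∈ μ → α v ≤ 0) ∧ (v ∉ μ → 0 ≤ α v) := by
  classical
  obtain ⟨f, hf⟩ := exists_linear_pos_signedVec a μ hsep
  obtain ⟨σ, β, Y, hcard, hdisj, hβ, hβ1, hY⟩ :=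
    exists_disjoint_sum_smul_eq (F := F) p hN0 (by simpa using hN) hm (signedVec a μ)
  have hfY : ∀ g, f Y = ∑ v ∈ σ g, β v * f (signedVec a μ v) := by
    intro g
    rw [← hY g, map_sum]
    exact Finset.sum_congr rfl fun v _ => by rw [map_smul, smul_eq_mul]
  have hne : f Y ≠ 0 := by
    intro h0
    have h1 : ∀ g, ∑ v ∈ σ g, β v = 0 := by
      intro g
      refine Finset.sum_eq_zero fun v hv => ?_
      have h2 := (Finset.sum_eq_zero_iff_of_nonneg fun v _ => mul_nonneg (hβ v) (hf v).le).1
        ((hfY g).symm.trans h0) v hv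
      exact (mul_eq_zero.1 h2).resolve_right (hf v).ne'
    rw [Finset.sum_eq_zero fun g _ => h1 g] at hβ1
    exact zero_ne_one hβ1
  obtain ⟨g₀, hg₀⟩ : ∃ g, ∀ v ∈ σ g, v ∉ μ := by
    by_contra! h
    choose w hwσ hwμ using h
    have hinj : Function.Injective w := by
      intro g g' h
      by_contra hgg'
      exact Finset.disjoint_left.1 (hdisj g g' hgg') (hwσ g) (h ▸ hwσ g')
    exact hμ.not_ge (Finset.card_le_card_of_injOn w (fun g _ => hwμ g) hinj.injOn)
  have hcoord : ∀ g j, ∑ v ∈ σ g, β v * (faceSign μ v * j.elim 1 (a v)) = Y j := by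
    intro g j
    rw [← hY g, Finset.sum_apply]
    rfl
  have hYsum : ∀ g, ∑ v ∈ σ g, faceSign μ v * β v = Y none := by
    intro g
    rw [← hcoord g none]
    exact Finset.sum_congr rfl fun v _ => by simp [mul_comm]
  have ht : 0 < Y none := by
    rw [← hYsum g₀]
    have h1 : ∀ v ∈ σ g₀, faceSign μ v * β v = β v := fun v hv => by
      rw [faceSign, if_neg (hg₀ v hv), one_mul]
    rw [Finset.sum_congr rfl h1]
    refine (Finset.sum_nonneg fun v _ => hβ v).lt_of_ne fun h0 => hne ?_
    rw [hfY g₀]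
    refine Finset.sum_eq_zero fun v hv => ?_
    rw [(Finset.sum_eq_zero_iff_of_nonneg fun v _ => hβ v).1 h0.symm v hv, zero_mul]
  refine ⟨σ, WithLp.toLp 2 fun j => Y (some j) / Y none, fun v => faceSign μ v * β v / Y none,
    fun g => ?_, hcard, hdisj, fun g => ?_, fun g => ?_, fun v => ⟨fun hv => ?_, fun hv => ?_⟩⟩
  · refine Finset.nonempty_iff_ne_empty.2 fun h => hne ?_
    rw [hfY g, h, Finset.sum_empty]
  · ext j
    have h := hcoord g (some j)
    simp only [Option.elim_some] at h
    simp only [WithLp.ofLp_sum, Finset.sum_apply, PiLp.smul_apply, smul_eq_mul]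
    rw [← h, Finset.sum_div]
    exact Finset.sum_congr rfl fun v _ => by ring
  · rw [← Finset.sum_div, hYsum, div_self ht.ne']
  · beta_reduce
    rw [faceSign, if_pos hv, neg_one_mul]
    exact div_nonpos_of_nonpos_of_nonneg (neg_nonpos.2 (hβ v)) ht.le
  · beta_reduce
    rw [faceSign, if_neg hv, one_mul]
    exact div_nonneg (hβ v) ht.le

end Signs

end AltChain

/-- **Plus minus generalized Van Kampen–Flores theorem.**
Here `r ≥ 2` is a prime power, `N = (r-1)(d+2)` and `k = ⌈((r-1)/r)·d⌉`.
Vertices of the simplex `Δ_N` are modeled by `Fin (N+1)`, faces by finsets of vertices,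
and the affine map `a : Δ_N → ℝ^d` by its values on the vertices.
The face `μ` has at most `r - 1` vertices and `a(μ) ∩ a(μ') = ∅`, where `μ' = μᶜ`.
The resulting faces `σ j` all have dimension at most `k`, i.e. at most `k + 1` vertices. -/
theorem plus_minus_generalized_van_kampen_flores
    (d r : ℕ) (hd : 1 ≤ d) (hr : 2 ≤ r) (hrpp : IsPrimePow r)
    (N : ℕ) (hN : N = (r - 1) * (d + 2))
    (k : ℕ) (hk : k = ⌈((r : ℝ) - 1) / (r : ℝ) * (d : ℝ)⌉₊)
    (a : Fin (N + 1) → EuclideanSpace ℝ (Fin d))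
    (μ : Finset (Fin (N + 1))) (hμcard : μ.card ≤ r - 1)
    (hsep : convexHull ℝ (a '' ↑μ) ∩ convexHull ℝ (a '' ↑μᶜ) = ∅) :
    ∃ (σ : Fin r → Finset (Fin (N + 1))) (b : EuclideanSpace ℝ (Fin d))
      (α : Fin (N + 1) → ℝ),
      (∀ j, (σ j).Nonempty) ∧
      (∀ j, (σ j).card ≤ k + 1) ∧
      (∀ j k', j ≠ k' → Disjoint (σ j) (σ k')) ∧
      (∀ j, ∑ v ∈ σ j, α v • a v = b) ∧
      (∀ j, ∑ v ∈ σ j, α v = 1) ∧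
      (∀ v, (∃ j, v ∈ σ j) → (v ∈ μ → α v ≤ 0) ∧ (v ∉ μ → 0 ≤ α v)) := by
  obtain ⟨p, t, hp, ht, rfl⟩ := (isPrimePow_nat_iff r).1 hrpp
  have : Fact p.Prime := ⟨hp⟩
  classical
  let F := GaloisField p t
  have : Fintype F := Fintype.ofFinite F
  have hF : Fintype.card F = p ^ t := by
    rw [← Nat.card_eq_fintype_card]
    exact GaloisField.card p t ht.ne'
  have hk' : (p ^ t - 1) * d ≤ p ^ t * k := by
    have hr0 : (0 : ℝ) < (p ^ t : ℕ) := by exact_mod_cast (by omega : 0 < p ^ t)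
    have h := Nat.le_ceil (((p ^ t : ℕ) - 1 : ℝ) / (p ^ t : ℕ) * (d : ℝ))
    rw [← hk, div_mul_eq_mul_div, div_le_iff₀ hr0] at h
    have h1 : (((p ^ t - 1 : ℕ) : ℝ)) = (p ^ t : ℕ) - 1 := by
      rw [Nat.cast_sub (by omega), Nat.cast_one]
    rw [← h1] at h
    rw [mul_comm (p ^ t) k]
    exact_mod_cast h
  obtain ⟨q, hq⟩ : ∃ q, p ^ t = q + 1 := ⟨p ^ t - 1, by omega⟩
  have hN0 : 0 < N := by
    rw [hN]
    exact Nat.mul_pos (by omega) (by omega)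
  have hm : N + 1 < Fintype.card F * (k + 1 + 1) := by
    rw [hF, hN]
    rw [hq, Nat.add_sub_cancel] at hk' ⊢
    nlinarith
  obtain ⟨σ, b, α, h1, h2, h3, h4, h5, h6⟩ := AltChain.exists_faces_of_field (F := F) p hN0
    (by rw [hF, hN]) hm a μ (by rw [hF]; omega) hsep
  let e : Fin (p ^ t) ≃ F := (Fintype.equivFinOfCardEq hF).symm
  exact ⟨fun j => σ (e j), b, α, fun j => h1 _, fun j => h2 _,
    fun j j' h => h3 _ _ fun h' => h (e.injective h'), fun j => h4 _, fun j => h5 _,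
    fun v _ => h6 v⟩
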